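/- Let K be a field of characteristic zero with algebraic closure K̄, F ∈ K[X_1,...,X_n]^{p×q} with p ≤ q, G = (g_1,...,g_s) ⊂ K[X_1,...,X_n], and n = q-p+s+1. Then the sum of the multiplicities of the isolated points of V(I_p(F) + ⟨g_1,...,g_s⟩) is at most deg(g_1)···deg(g_s)·E_{n-s}(cdeg(F,1),...,cdeg(F,q)), where cdeg(F,j) = max_i deg(f_{i,j}) and E_k is the elementary symmetric polynomial of degree k. -/

import Mathlib

open MvPolynomial Finset

/-- `x` is an isolated point of the zero set `V(I)` (Zariski topology). -/
def IsIsolatedZero {σ K : Type*} [CommRing K] (I : Ideal (MvPolynomial σ K))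
    (x : σ → K) : Prop :=
  (∀ f ∈ I, MvPolynomial.eval x f = 0) ∧
  ∃ h : MvPolynomial σ K, MvPolynomial.eval x h ≠ 0 ∧
    ∀ y : σ → K, (∀ f ∈ I, MvPolynomial.eval y f = 0) → MvPolynomial.eval y h ≠ 0 → y = x

/-- Multiplicity of `pt` with respect to `I`: the dimension of the formal power
series quotient after translating `pt` to the origin. -/
noncomputable def multAt {σ K : Type*} [Field K]
    (I : Ideal (MvPolynomial σ K)) (pt : σ → K) : ℕ :=
  Module.finrank K (MvPowerSeries σ K ⧸
    Ideal.map ((MvPolynomial.coeToMvPowerSeries.ringHom).comp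
      ((MvPolynomial.aeval
        (fun v => MvPolynomial.X v + MvPolynomial.C (pt v)) :
          MvPolynomial σ K →ₐ[K] MvPolynomial σ K)).toRingHom) I)

/-- The determinantal ideal `I_p(F) + ⟨g₁,…,g_s⟩` extended to the algebraic closure. -/
noncomputable def detIdeal {K : Type*} [Field K] {p q s n : ℕ}
    (F : Matrix (Fin p) (Fin q) (MvPolynomial (Fin n) K))
    (g : Fin s → MvPolynomial (Fin n) K) :
    Ideal (MvPolynomial (Fin n) (AlgebraicClosure K)) :=
  Ideal.span {d : MvPolynomial (Fin n) (AlgebraicClosure K) |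
      ∃ c : Fin p ↪ Fin q,
        d = ((F.map (MvPolynomial.map (algebraMap K (AlgebraicClosure K)))).submatrix id c).det}
    ⊔ Ideal.span (Set.range fun i => MvPolynomial.map (algebraMap K (AlgebraicClosure K)) (g i))

namespace DetBound

section Systems

variable {R S : Type*} [CommRing R] [CommRing S] {p q s : ℕ}

/-- The generators of the ideal of a determinantal system: the maximal minors of `F`
(indexed by injections of columns) and the polynomials `g i`. -/
def sysGen (F : Matrix (Fin p) (Fin q) R) (g : Fin s → R) : (Fin p ↪ Fin q) ⊕ Fin s → R :=
  Sum.elim (fun c => (F.submatrix id c).det) g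

/-- The ideal of a determinantal system. -/
def sysIdeal (F : Matrix (Fin p) (Fin q) R) (g : Fin s → R) : Ideal R :=
  Ideal.span (Set.range (sysGen F g))

lemma sysGen_mem (F : Matrix (Fin p) (Fin q) R) (g : Fin s → R) (a) :
    sysGen F g a ∈ sysIdeal F g := Ideal.subset_span ⟨a, rfl⟩

lemma sysGen_map (φ : R →+* S) (F : Matrix (Fin p) (Fin q) R) (g : Fin s → R) (a) :
    sysGen (F.map φ) (fun i => φ (g i)) a = φ (sysGen F g a) := by
  rcases a with c | i
  · simp [sysGen, RingHom.map_det, Matrix.submatrix_map]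
  · simp [sysGen]

lemma map_sysIdeal (φ : R →+* S) (F : Matrix (Fin p) (Fin q) R) (g : Fin s → R) :
    (sysIdeal F g).map φ = sysIdeal (F.map φ) (fun i => φ (g i)) := by
  rw [sysIdeal, sysIdeal, Ideal.map_span, ← Set.range_comp]
  congr 2
  funext a
  simp [sysGen_map]

lemma sysIdeal_le_of_congr (Q : Ideal R) {F F' : Matrix (Fin p) (Fin q) R} {g g' : Fin s → R}
    (hF : ∀ i j, F i j - F' i j ∈ Q) (hg : ∀ i, g i - g' i ∈ Q) :
    sysIdeal F g ≤ sysIdeal F' g' ⊔ Q := by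
  have h1 : F.map (Ideal.Quotient.mk Q) = F'.map (Ideal.Quotient.mk Q) := by
    ext i j
    simpa using Ideal.Quotient.eq.2 (hF i j)
  have h2 : (fun i => Ideal.Quotient.mk Q (g i)) = fun i => Ideal.Quotient.mk Q (g' i) := by
    funext i
    exact Ideal.Quotient.eq.2 (hg i)
  have h3 : (sysIdeal F g).map (Ideal.Quotient.mk Q) =
      (sysIdeal F' g').map (Ideal.Quotient.mk Q) := by
    rw [map_sysIdeal, map_sysIdeal, h1, h2]
  calc sysIdeal F g ≤ ((sysIdeal F g).map (Ideal.Quotient.mk Q)).comap (Ideal.Quotient.mk Q) :=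
        Ideal.le_comap_map
    _ = sysIdeal F' g' ⊔ Q := by
        rw [h3, Ideal.comap_map_of_surjective _ Ideal.Quotient.mk_surjective, ← RingHom.ker,
          Ideal.mk_ker]

end Systems

section Degrees

variable {σ R : Type*} [CommRing R]

/-- Polynomials all of whose monomials have degree `< d`. -/
def degLT (σ R : Type*) [CommRing R] (d : ℕ) : Submodule R (MvPolynomial σ R) where
  carrier := {f | ∀ m : σ →₀ ℕ, d ≤ m.degree → coeff m f = 0}
  add_mem' := fun {a b} ha hb m hm => by simp [ha m hm, hb m hm]
  zero_mem' := fun m _ => by simp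
  smul_mem' := fun c f hf m hm => by simp [hf m hm]

lemma degLT_mono {d d' : ℕ} (h : d ≤ d') : degLT σ R d ≤ degLT σ R d' :=
  fun _ hf m hm => hf m (h.trans hm)

lemma mul_mem_degLT {a b : ℕ} {f g : MvPolynomial σ R} (hf : f ∈ degLT σ R a)
    (hg : g ∈ degLT σ R (b + 1)) : f * g ∈ degLT σ R (a + b) := by
  classical
  intro m hm
  rw [coeff_mul]
  refine Finset.sum_eq_zero fun x hx => ?_
  rw [Finset.HasAntidiagonal.mem_antidiagonal] at hx
  have : m.degree = x.1.degree + x.2.degree := by rw [← hx, map_add]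
  by_cases h : a ≤ x.1.degree
  · rw [hf _ h, zero_mul]
  · rw [hg x.2 (by omega), mul_zero]

lemma mul_mem_degLT_succ {a b : ℕ} {f g : MvPolynomial σ R} (hf : f ∈ degLT σ R (a + 1))
    (hg : g ∈ degLT σ R (b + 1)) : f * g ∈ degLT σ R (a + b + 1) := by
  have := mul_mem_degLT hf hg
  rwa [show a + 1 + b = a + b + 1 by ring] at this

lemma one_mem_degLT : (1 : MvPolynomial σ R) ∈ degLT σ R 1 := by
  classical
  intro m hm
  rw [coeff_one, if_neg]
  rintro rfl
  simp at hm

lemma prod_mem_degLT {ι : Type*} (s : Finset ι) (d : ι → ℕ) (f : ι → MvPolynomial σ R)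
    (h : ∀ i ∈ s, f i ∈ degLT σ R (d i + 1)) :
    ∏ i ∈ s, f i ∈ degLT σ R (∑ i ∈ s, d i + 1) := by
  classical
  induction s using Finset.induction_on with
  | empty => simpa using one_mem_degLT
  | insert a s ha ih =>
    rw [Finset.prod_insert ha, Finset.sum_insert ha]
    exact mul_mem_degLT_succ (h a (by simp)) (ih fun i hi => h i (by simp [hi]))

lemma mem_degLT_of_totalDegree_le {d : ℕ} {f : MvPolynomial σ R} (h : f.totalDegree ≤ d) :
    f ∈ degLT σ R (d + 1) := by
  intro m hm
  by_contra hc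
  have := le_totalDegree (mem_support_iff.2 hc)
  change m.degree ≤ _ at this
  omega

lemma mem_degLT_of_isHomogeneous {d : ℕ} {f : MvPolynomial σ R} (h : f.IsHomogeneous d) :
    f ∈ degLT σ R (d + 1) := mem_degLT_of_totalDegree_le h.totalDegree_le

lemma exists_mem_degLT (f : MvPolynomial σ R) : f ∈ degLT σ R (f.totalDegree + 1) :=
  mem_degLT_of_totalDegree_le le_rfl

lemma C_mem_degLT (c : R) : (C c : MvPolynomial σ R) ∈ degLT σ R 1 :=
  mem_degLT_of_totalDegree_le (by simp)

lemma map_mem_degLT {S : Type*} [CommRing S] (φ : R →+* S) {d : ℕ} {f : MvPolynomial σ R}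
    (h : f ∈ degLT σ R d) : map φ f ∈ degLT σ S d := by
  intro m hm
  rw [coeff_map, h m hm, map_zero]

/-- `m` is the homogeneous part of degree `d` of `f`, and `f` has degree at most `d`. -/
def IsTop (d : ℕ) (f m : MvPolynomial σ R) : Prop :=
  m.IsHomogeneous d ∧ f - m ∈ degLT σ R d

lemma IsTop.mem_degLT {d : ℕ} {f m : MvPolynomial σ R} (h : IsTop d f m) :
    f ∈ degLT σ R (d + 1) := by
  have := add_mem (degLT_mono d.le_succ h.2) (mem_degLT_of_isHomogeneous h.1)
  simpa using this

lemma IsTop.mul {d e : ℕ} {f m f' m' : MvPolynomial σ R} (h : IsTop d f m) (h' : IsTop e f' m') :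
    IsTop (d + e) (f * f') (m * m') := by
  refine ⟨h.1.mul h'.1, ?_⟩
  have h1 := mul_mem_degLT h.2 h'.mem_degLT
  have h2 := mul_mem_degLT h'.2 (mem_degLT_of_isHomogeneous h.1)
  rw [add_comm e d] at h2
  have := add_mem h1 h2
  convert! this using 1
  ring

lemma IsTop.one : IsTop 0 (1 : MvPolynomial σ R) 1 :=
  ⟨isHomogeneous_one _ _, by simp⟩

lemma IsTop.prod {ι : Type*} (s : Finset ι) (d : ι → ℕ) (f m : ι → MvPolynomial σ R)
    (h : ∀ i ∈ s, IsTop (d i) (f i) (m i)) :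
    IsTop (∑ i ∈ s, d i) (∏ i ∈ s, f i) (∏ i ∈ s, m i) := by
  classical
  induction s using Finset.induction_on with
  | empty => simpa using IsTop.one
  | insert a s ha ih =>
    rw [Finset.prod_insert ha, Finset.prod_insert ha, Finset.sum_insert ha]
    exact (h a (by simp)).mul (ih fun i hi => h i (by simp [hi]))

lemma IsTop.smul {d : ℕ} {f m : MvPolynomial σ R} (h : IsTop d f m) (c : R) :
    IsTop d (c • f) (c • m) := by
  refine ⟨?_, ?_⟩
  · rw [smul_eq_C_mul]; exact h.1.C_mul c
  · rw [← smul_sub]; exact Submodule.smul_mem _ _ h.2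

lemma IsTop.C_mul {d : ℕ} {f m : MvPolynomial σ R} (h : IsTop d f m) (c : R) :
    IsTop d (C c * f) (C c * m) := by
  simpa [smul_eq_C_mul] using h.smul c

lemma IsTop.sum {ι : Type*} (s : Finset ι) {d : ℕ} (f m : ι → MvPolynomial σ R)
    (h : ∀ i ∈ s, IsTop d (f i) (m i)) :
    IsTop d (∑ i ∈ s, f i) (∑ i ∈ s, m i) := by
  refine ⟨IsHomogeneous.sum _ _ _ fun i hi => (h i hi).1, ?_⟩
  rw [← Finset.sum_sub_distrib]
  exact Submodule.sum_mem _ fun i hi => (h i hi).2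

lemma IsTop.map {S : Type*} [CommRing S] (φ : R →+* S) {d : ℕ} {f m : MvPolynomial σ R}
    (h : IsTop d f m) : IsTop d (map φ f) (map φ m) :=
  ⟨h.1.map φ, by rw [← map_sub]; exact map_mem_degLT φ h.2⟩

lemma IsTop.add_low {d : ℕ} {f m g : MvPolynomial σ R} (h : IsTop d f m) (hg : g ∈ degLT σ R d) :
    IsTop d (f + g) m :=
  ⟨h.1, by convert! add_mem h.2 hg using 1; ring⟩

variable {p q s : ℕ}

/-- The formal degrees of the generators of a determinantal system. -/
def genDeg (p : ℕ) (d : Fin q ⊕ Fin s → ℕ) : (Fin p ↪ Fin q) ⊕ Fin s → ℕ :=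
  Sum.elim (fun c => ∑ i, d (Sum.inl (c i))) (fun i => d (Sum.inr i))

lemma sysGen_isTop {d : Fin q ⊕ Fin s → ℕ} {F M : Matrix (Fin p) (Fin q) (MvPolynomial σ R)}
    {g b : Fin s → MvPolynomial σ R} (hF : ∀ i j, IsTop (d (Sum.inl j)) (F i j) (M i j))
    (hg : ∀ i, IsTop (d (Sum.inr i)) (g i) (b i)) (a) :
    IsTop (genDeg p d a) (sysGen F g a) (sysGen M b a) := by
  rcases a with c | i
  · simp only [sysGen, genDeg, Sum.elim_inl, Matrix.det_apply]
    refine IsTop.sum _ _ _ fun τ _ => ?_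
    have := IsTop.prod Finset.univ (fun i => d (Sum.inl (c i)))
      (fun i => (F.submatrix id c) (τ i) i) (fun i => (M.submatrix id c) (τ i) i)
      (fun i _ => hF _ _)
    rcases Int.units_eq_one_or (Equiv.Perm.sign τ) with h | h
    · simpa [h] using this
    · have := this.smul (-1)
      simpa [h] using this
  · exact hg i

lemma sysGen_mem_degLT {d : Fin q ⊕ Fin s → ℕ} {F : Matrix (Fin p) (Fin q) (MvPolynomial σ R)}
    {g : Fin s → MvPolynomial σ R} (hF : ∀ i j, F i j ∈ degLT σ R (d (Sum.inl j) + 1))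
    (hg : ∀ i, g i ∈ degLT σ R (d (Sum.inr i) + 1)) (a) :
    sysGen F g a ∈ degLT σ R (genDeg p d a + 1) := by
  rcases a with c | i
  · simp only [sysGen, genDeg, Sum.elim_inl, Matrix.det_apply]
    refine Submodule.sum_mem _ fun τ _ => ?_
    have := prod_mem_degLT Finset.univ (fun i => d (Sum.inl (c i)))
      (fun i => (F.submatrix id c) (τ i) i) (fun i _ => hF _ _)
    rcases Int.units_eq_one_or (Equiv.Perm.sign τ) with h | h
    · simpa [h] using this
    · simpa [h] using this
  · exact hg i

lemma homogeneousComponent_mul_of_isHomogeneous {d : ℕ} (c : MvPolynomial σ R)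
    {m : MvPolynomial σ R} (hm : m.IsHomogeneous d) (δ : ℕ) :
    homogeneousComponent δ (c * m) =
      if d ≤ δ then homogeneousComponent (δ - d) c * m else 0 := by
  classical
  conv_lhs => rw [← sum_homogeneousComponent c, Finset.sum_mul, map_sum]
  have key : ∀ i, homogeneousComponent δ (homogeneousComponent i c * m) =
      if δ = i + d then homogeneousComponent i c * m else 0 := fun i =>
    homogeneousComponent_of_mem ((homogeneousComponent_isHomogeneous i c).mul hm)
  simp only [key]
  split_ifs with h
  · rw [Finset.sum_eq_single (δ - d)]
    · rw [if_pos (by omega)]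
    · intro b _ hb
      rw [if_neg (by omega)]
    · intro hb
      rw [if_pos (by omega), homogeneousComponent_eq_zero, zero_mul]
      simp only [Finset.mem_range] at hb
      omega
  · exact Finset.sum_eq_zero fun i _ => by rw [if_neg (by omega)]

end Degrees

section Spanning

variable {σ k : Type*} [Field k] {ι : Type*} [Fintype ι] {D : ℕ}

/-- The polynomials `B i` span `k[X]` modulo `I`. -/
def SpansMod {R : Type*} [CommRing R] (B : Fin D → MvPolynomial σ R)
    (I : Ideal (MvPolynomial σ R)) : Prop :=
  ∀ f, ∃ r : Fin D → R, f - ∑ i, C (r i) * B i ∈ I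

lemma exists_homogeneous_combination {m : ι → MvPolynomial σ k} {δ : ι → ℕ}
    (hm : ∀ a, (m a).IsHomogeneous (δ a)) {B : Fin D → MvPolynomial σ k} {β : Fin D → ℕ}
    (hB : ∀ i, (B i).IsHomogeneous (β i)) (hspan : SpansMod B (Ideal.span (Set.range m)))
    {d : ℕ} {f : MvPolynomial σ k} (hf : f.IsHomogeneous d) :
    ∃ (r : Fin D → k) (c : ι → MvPolynomial σ k),
      (∀ a, c a = 0 ∨ δ a ≤ d ∧ (c a).IsHomogeneous (d - δ a)) ∧
      f = ∑ i, C (r i) * B i + ∑ a, c a * m a := by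
  obtain ⟨r, hr⟩ := hspan f
  obtain ⟨c, hc⟩ := (Ideal.mem_span_range_iff_exists_fun).1 hr
  refine ⟨fun i => if d = β i then r i else 0,
    fun a => if δ a ≤ d then homogeneousComponent (d - δ a) (c a) else 0, fun a => ?_, ?_⟩
  · by_cases h : δ a ≤ d
    · right
      simp only [h, if_true, true_and]
      exact homogeneousComponent_isHomogeneous _ _
    · left; simp [h]
  · have h1 : f = ∑ i, C (r i) * B i + ∑ a, c a * m a := by rw [hc]; ring
    have h2 := congrArg (homogeneousComponent d) h1
    rw [homogeneousComponent_eq_self hf, map_add, map_sum, map_sum] at h2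
    conv_lhs => rw [h2]
    congr 1
    · refine Finset.sum_congr rfl fun i _ => ?_
      rw [homogeneousComponent_C_mul, homogeneousComponent_of_mem (hB i)]
      split_ifs with h0 <;> simp [h0]
    · refine Finset.sum_congr rfl fun a _ => ?_
      rw [homogeneousComponent_mul_of_isHomogeneous _ (hm a)]
      split_ifs with h0 <;> simp [h0]

/-- A homogeneous spanning set modulo the ideal of leading forms spans modulo any ideal
generated by polynomials with these leading forms. -/
lemma SpansMod.of_isTop {Λ : Type*} [CommRing Λ] [Algebra k Λ]
    {m : ι → MvPolynomial σ k} {δ : ι → ℕ}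
    {B : Fin D → MvPolynomial σ k} {β : Fin D → ℕ} (hm : ∀ a, (m a).IsHomogeneous (δ a))
    (hB : ∀ i, (B i).IsHomogeneous (β i)) (hspan : SpansMod B (Ideal.span (Set.range m)))
    {h : ι → MvPolynomial σ Λ} (hh : ∀ a, IsTop (δ a) (h a) (map (algebraMap k Λ) (m a))) :
    SpansMod (fun i => map (algebraMap k Λ) (B i)) (Ideal.span (Set.range h)) := by
  classical
  set I := Ideal.span (Set.range h) with hI
  have add_ok : ∀ f g, (∃ r : Fin D → Λ, f - ∑ i, C (r i) * map (algebraMap k Λ) (B i) ∈ I) →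
      (∃ r : Fin D → Λ, g - ∑ i, C (r i) * map (algebraMap k Λ) (B i) ∈ I) →
      (∃ r : Fin D → Λ, f + g - ∑ i, C (r i) * map (algebraMap k Λ) (B i) ∈ I) := by
    rintro f g ⟨r, hr⟩ ⟨r', hr'⟩
    refine ⟨r + r', ?_⟩
    convert! I.add_mem hr hr' using 1
    simp only [Pi.add_apply, map_add, add_mul, Finset.sum_add_distrib]
    ring
  have key : ∀ d, ∀ f ∈ degLT σ Λ d,
      ∃ r : Fin D → Λ, f - ∑ i, C (r i) * map (algebraMap k Λ) (B i) ∈ I := by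
    intro d
    induction d with
    | zero =>
      intro f hf
      have : f = 0 := by ext m; simpa using hf m (Nat.zero_le _)
      exact ⟨0, by simp [this]⟩
    | succ d ih =>
      have mono : ∀ mon : σ →₀ ℕ, mon.degree = d → ∀ c : Λ,
          ∃ r : Fin D → Λ, monomial mon c - ∑ i, C (r i) * map (algebraMap k Λ) (B i) ∈ I := by
        intro mon hmon c
        obtain ⟨r, e, he, heq⟩ := exists_homogeneous_combination hm hB hspan
          (isHomogeneous_monomial (1 : k) hmon)
        have h1 : monomial mon c = C c * map (algebraMap k Λ) (monomial mon (1 : k)) := by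
          rw [map_monomial, C_mul_monomial]; simp
        set low : MvPolynomial σ Λ :=
          ∑ a, C c * (map (algebraMap k Λ) (e a) * (map (algebraMap k Λ) (m a) - h a)) with hlow
        have hlowmem : low ∈ degLT σ Λ d := by
          refine Submodule.sum_mem _ fun a _ => ?_
          rw [← smul_eq_C_mul]
          refine Submodule.smul_mem _ _ ?_
          rcases he a with h0 | ⟨h0, h0'⟩
          · simp [h0]
          · have := mul_mem_degLT (neg_mem (hh a).2)
              (mem_degLT_of_isHomogeneous (h0'.map (algebraMap k Λ)))
            rw [neg_sub, Nat.add_sub_cancel' h0, mul_comm] at this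
            exact this
        have hmain : ∃ r : Fin D → Λ, (monomial mon c - low) -
            ∑ i, C (r i) * map (algebraMap k Λ) (B i) ∈ I := by
          refine ⟨fun i => c * algebraMap k Λ (r i), ?_⟩
          have : (monomial mon c - low) - ∑ i, C (c * algebraMap k Λ (r i)) *
              map (algebraMap k Λ) (B i) = ∑ a, C c * map (algebraMap k Λ) (e a) * h a := by
            rw [h1, heq, hlow]
            simp only [map_add, map_sum, map_mul, map_C, mul_add, Finset.mul_sum, mul_sub,
              Finset.sum_sub_distrib, mul_assoc]
            ring
          rw [this]
          exact I.sum_mem fun a _ => I.mul_mem_left _ (Ideal.subset_span ⟨a, rfl⟩)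
        have := add_ok _ _ hmain (ih low hlowmem)
        simpa using this
      intro f hf
      have hsum : ∀ s : Finset (σ →₀ ℕ), (∀ mon ∈ s, mon.degree < d + 1) →
          ∃ r : Fin D → Λ, (∑ mon ∈ s, monomial mon (coeff mon f)) -
            ∑ i, C (r i) * map (algebraMap k Λ) (B i) ∈ I := by
        intro s
        induction s using Finset.induction_on with
        | empty => exact fun _ => ⟨0, by simp⟩
        | insert mon s hmon ihs =>
          intro hs
          rw [Finset.sum_insert hmon]
          refine add_ok _ _ ?_ (ihs fun x hx => hs x (by simp [hx]))
          have := hs mon (by simp)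
          rcases Nat.lt_succ_iff_lt_or_eq.1 this with h0 | h0
          · refine ih _ fun x hx => ?_
            rw [coeff_monomial, if_neg]
            rintro rfl
            omega
          · exact mono mon h0 _
      have := hsum f.support fun mon hmon => by
        by_contra hc
        exact (mem_support_iff.1 hmon) (hf mon (by omega))
      rwa [← f.as_sum] at this
  exact fun f => key _ f (exists_mem_degLT f)

end Spanning

section Vandermonde

variable {k : Type*} [Field k]

lemma mem_of_vandermonde {A : Type*} [AddCommGroup A] [Module k A] (J : Submodule k A) {n : ℕ}
    {θ : Fin n → k} (hθ : Function.Injective θ) (v : Fin n → A)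
    (h : ∀ a, ∑ m : Fin n, θ a ^ (m : ℕ) • v m ∈ J) (m : Fin n) : v m ∈ J := by
  have hdet : IsUnit (Matrix.vandermonde θ).det :=
    isUnit_iff_ne_zero.2 (Matrix.det_vandermonde_ne_zero_iff.2 hθ)
  have key : v m = ∑ a, (Matrix.vandermonde θ)⁻¹ m a • ∑ b : Fin n, θ a ^ (b : ℕ) • v b := by
    simp only [Finset.smul_sum, smul_smul]
    rw [Finset.sum_comm]
    simp only [← Finset.sum_smul]
    have : ∀ b : Fin n, ∑ a, (Matrix.vandermonde θ)⁻¹ m a * θ a ^ (b : ℕ) =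
        (1 : Matrix (Fin n) (Fin n) k) m b := fun b => by
      rw [← Matrix.nonsing_inv_mul _ hdet]
      rfl
    simp [this, Matrix.one_apply]
  rw [key]
  exact Submodule.sum_mem _ fun a _ => Submodule.smul_mem _ _ (h a)

lemma mem_of_vandermonde_finset {A : Type*} [AddCommGroup A] [Module k A] (J : Submodule k A)
    {n : ℕ} {ι : Type*} {T : Finset ι} (hT : T.card = n) {θ : ι → k}
    (hθ : Set.InjOn θ T) (v : Fin n → A)
    (h : ∀ a ∈ T, ∑ m : Fin n, θ a ^ (m : ℕ) • v m ∈ J) (m : Fin n) : v m ∈ J := by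
  let e := T.equivFinOfCardEq hT
  refine mem_of_vandermonde J (θ := fun a => θ (e.symm a)) (fun a b hab => ?_) v
    (fun a => h _ (e.symm a).2) m
  exact e.symm.injective (Subtype.ext (hθ (e.symm a).2 (e.symm b).2 hab))

end Vandermonde

section HomogeneousSpanning

variable {σ k : Type*} [Field k]

/-- The quotient by `I` is spanned by `D` homogeneous polynomials. -/
def HSpans (I : Ideal (MvPolynomial σ k)) (D : ℕ) : Prop :=
  ∃ (B : Fin D → MvPolynomial σ k) (β : Fin D → ℕ),
    (∀ i, (B i).IsHomogeneous (β i)) ∧ SpansMod B I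

variable {I I' : Ideal (MvPolynomial σ k)} {D D' : ℕ}

lemma HSpans.mono (hI : I ≤ I') (h : HSpans I D) : HSpans I' D := by
  obtain ⟨B, β, hB, hs⟩ := h
  exact ⟨B, β, hB, fun f => (hs f).imp fun r hr => hI hr⟩

lemma HSpans.top (D : ℕ) : HSpans (⊤ : Ideal (MvPolynomial σ k)) D :=
  ⟨0, 0, fun _ => isHomogeneous_zero _ _ _, fun _ => ⟨0, trivial⟩⟩

lemma HSpans.add {a : MvPolynomial σ k} {e : ℕ} (ha : a.IsHomogeneous e)
    (h : HSpans (I ⊔ Ideal.span {a}) D) (h' : HSpans I' D') (hmul : ∀ f ∈ I', a * f ∈ I) :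
    HSpans I (D + D') := by
  obtain ⟨B, β, hB, hs⟩ := h
  obtain ⟨B', β', hB', hs'⟩ := h'
  refine ⟨Fin.append B (fun i => a * B' i), Fin.append β (fun i => e + β' i), fun i => ?_,
    fun f => ?_⟩
  · refine Fin.addCases (fun i => ?_) (fun i => ?_) i
    · simpa using hB i
    · simpa using ha.mul (hB' i)
  · obtain ⟨r, hr⟩ := hs f
    obtain ⟨y, hy, z, hz, hyz⟩ := Submodule.mem_sup.1 hr
    obtain ⟨g, rfl⟩ := Ideal.mem_span_singleton'.1 hz
    obtain ⟨r', hr'⟩ := hs' g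
    refine ⟨Fin.append r r', ?_⟩
    have := I.add_mem hy (hmul _ hr')
    convert! this using 1
    rw [Fin.sum_univ_add]
    simp only [Fin.append_left, Fin.append_right, mul_sub, Finset.mul_sum]
    rw [← sub_sub, ← hyz]
    have : ∀ i, C (r' i) * (a * B' i) = a * (C (r' i) * B' i) := fun i => by ring
    simp only [this]
    ring

lemma HSpans.prod {ι : Type*} (S : Finset ι) (l : ι → MvPolynomial σ k)
    (hl : ∀ i, (l i).IsHomogeneous 1) (h : ∀ i, HSpans (I ⊔ Ideal.span {l i}) D) :
    HSpans (I ⊔ Ideal.span {∏ i ∈ S, l i}) (S.card * D) := by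
  classical
  induction S using Finset.induction_on with
  | empty => exact (HSpans.top _).mono (by simp)
  | insert a S ha ih =>
    rw [Finset.card_insert_of_notMem ha, add_mul, one_mul, add_comm, Finset.prod_insert ha]
    refine HSpans.add (hl a) ((h a).mono (sup_le_sup_right le_sup_left _)) ih fun f hf => ?_
    obtain ⟨y, hy, z, hz, rfl⟩ := Submodule.mem_sup.1 hf
    obtain ⟨g, rfl⟩ := Ideal.mem_span_singleton'.1 hz
    rw [mul_add]
    refine add_mem (Ideal.mem_sup_left (Ideal.mul_mem_left _ _ hy)) (Ideal.mem_sup_right ?_)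
    exact Ideal.mem_span_singleton'.2 ⟨g, by ring⟩

lemma sub_C_constantCoeff_mem (hX : ∀ i, X i ∈ I) (f : MvPolynomial σ k) :
    f - C (constantCoeff f) ∈ I := by
  induction f using MvPolynomial.induction_on with
  | C a => simp
  | add f g hf hg =>
    convert! I.add_mem hf hg using 1
    simp only [map_add]
    ring
  | mul_X f i _ => simpa using I.mul_mem_left f (hX i)

lemma HSpans.of_X_mem (hX : ∀ i, X i ∈ I) : HSpans I 1 :=
  ⟨fun _ => 1, fun _ => 0, fun _ => isHomogeneous_one _ _, fun f =>
    ⟨fun _ => constantCoeff f, by simpa using sub_C_constantCoeff_mem hX f⟩⟩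

end HomogeneousSpanning

section Star

variable {k : Type*} [Field k] {p q s n : ℕ}

/-- The linear form whose coefficients are the powers of `θ`. -/
noncomputable def powForm (n : ℕ) (θ : k) : MvPolynomial (Fin n) k :=
  ∑ m : Fin n, C (θ ^ (m : ℕ)) * X m

lemma powForm_isHomogeneous (θ : k) : (powForm n θ).IsHomogeneous 1 :=
  IsHomogeneous.sum _ _ _ fun m _ => (isHomogeneous_X k m).C_mul _

/-- Pairwise distinct scalars indexed by the linear factors of a star system. -/
def node (k : Type*) [Field k] (a : (Fin q ⊕ Fin s) × ℕ) : k := (Encodable.encode a : k)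

lemma node_injective [CharZero k] :
    Function.Injective (node k : (Fin q ⊕ Fin s) × ℕ → k) := fun a b h => by
  simpa [node] using h

/-- A product of `d j` affine linear polynomials with prescribed constant terms. -/
noncomputable def starProd (n : ℕ) (d : Fin q ⊕ Fin s → ℕ) (c : (Fin q ⊕ Fin s) × ℕ → k)
    (j : Fin q ⊕ Fin s) : MvPolynomial (Fin n) k :=
  ∏ l ∈ range (d j), (powForm n (node k (j, l)) - C (c (j, l)))

/-- The matrix of a star system. -/
noncomputable def starMat (p n : ℕ) (d : Fin q ⊕ Fin s → ℕ) (c : (Fin q ⊕ Fin s) × ℕ → k) :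
    Matrix (Fin p) (Fin q) (MvPolynomial (Fin n) k) :=
  Matrix.of fun i j => C ((j : k) ^ (i : ℕ)) * starProd n d c (Sum.inl j)

/-- The additional equations of a star system. -/
noncomputable def starEqs (n : ℕ) (d : Fin q ⊕ Fin s → ℕ) (c : (Fin q ⊕ Fin s) × ℕ → k) :
    Fin s → MvPolynomial (Fin n) k :=
  fun i => starProd n d c (Sum.inr i)

lemma starProd_isTop (d : Fin q ⊕ Fin s → ℕ) (c : (Fin q ⊕ Fin s) × ℕ → k) (j) :
    IsTop (d j) (starProd n d c j) (starProd n d 0 j) := by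
  have := IsTop.prod (range (d j)) (fun _ => 1)
    (fun l => powForm n (node k (j, l)) - C (c (j, l)))
    (fun l => powForm n (node k (j, l)) - C ((0 : (Fin q ⊕ Fin s) × ℕ → k) (j, l)))
    (fun l _ => ⟨by simpa using powForm_isHomogeneous _, by simpa using C_mem_degLT _⟩)
  simpa [starProd] using this

lemma starMat_isTop (d : Fin q ⊕ Fin s → ℕ) (c : (Fin q ⊕ Fin s) × ℕ → k) (i : Fin p) (j) :
    IsTop (d (Sum.inl j)) (starMat p n d c i j) (starMat p n d 0 i j) :=
  (starProd_isTop d c _).C_mul _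

lemma starMat_minor (d : Fin q ⊕ Fin s → ℕ) (c : (Fin q ⊕ Fin s) × ℕ → k) (e : Fin p → Fin q) :
    ((starMat p n d c).submatrix id e).det =
      C (Matrix.vandermonde fun i => (e i : k)).det * ∏ i, starProd n d c (Sum.inl (e i)) := by
  have h : (starMat p n d c).submatrix id e = Matrix.of fun i j =>
      starProd n d c (Sum.inl (e j)) *
        ((Matrix.vandermonde fun i => (e i : k)).transpose.map C) i j := by
    ext i j : 2
    simp [starMat, mul_comm, Matrix.vandermonde_apply]
  rw [h, Matrix.det_mul_row, ← RingHom.mapMatrix_apply, ← RingHom.map_det, Matrix.det_transpose,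
    mul_comm]

lemma vandermonde_cast_det_ne_zero [CharZero k] (e : Fin p ↪ Fin q) :
    (Matrix.vandermonde fun i => (e i : k)).det ≠ 0 := by
  refine Matrix.det_vandermonde_ne_zero_iff.2 fun a b h => e.injective (Fin.ext ?_)
  exact Nat.cast_injective h

lemma prod_starProd_mem_sysIdeal [CharZero k] (d : Fin q ⊕ Fin s → ℕ)
    (c : (Fin q ⊕ Fin s) × ℕ → k) {J : Finset (Fin q)} (hJ : J.card = p) :
    ∏ j ∈ J, starProd n d c (Sum.inl j) ∈ sysIdeal (starMat p n d c) (starEqs n d c) := by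
  let e : Fin p ↪ Fin q := (J.orderEmbOfFin hJ).toEmbedding
  have h1 := sysGen_mem (starMat p n d c) (starEqs n d c) (Sum.inl e)
  simp only [sysGen, Sum.elim_inl, starMat_minor] at h1
  have h2 := Ideal.mul_mem_left _ (C (Matrix.vandermonde fun i => (e i : k)).det⁻¹) h1
  rw [← mul_assoc, ← C_mul, inv_mul_cancel₀ (vandermonde_cast_det_ne_zero e), C_1, one_mul] at h2
  convert! h2 using 1
  rw [← Finset.prod_map univ e (fun j => starProd n d c (Sum.inl j))]
  congr 1
  ext x
  simp only [Finset.mem_map, mem_univ, true_and]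
  have := Finset.range_orderEmbOfFin J hJ
  rw [← Finset.mem_coe, ← this]
  rfl

/-- The ideal generated by linear forms, products of linear forms and all products of `p`
of the remaining products. -/
noncomputable def starIdeal (n : ℕ) (d : Fin q ⊕ Fin s → ℕ) (T : Finset ((Fin q ⊕ Fin s) × ℕ))
    (G Q : Finset (Fin q ⊕ Fin s)) (p : ℕ) : Ideal (MvPolynomial (Fin n) k) :=
  Ideal.span ((fun t => powForm n (node k t)) '' (T : Set ((Fin q ⊕ Fin s) × ℕ))) ⊔
    Ideal.span (starProd n d 0 '' (G : Set (Fin q ⊕ Fin s))) ⊔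
    Ideal.span ((fun J => ∏ j ∈ J, starProd n d 0 j) ''
      (powersetCard p Q : Set (Finset (Fin q ⊕ Fin s))))

variable {d : Fin q ⊕ Fin s → ℕ} {T : Finset ((Fin q ⊕ Fin s) × ℕ)} {G Q : Finset (Fin q ⊕ Fin s)}

lemma powForm_mem_starIdeal {t} (ht : t ∈ T) :
    powForm n (node k t) ∈ starIdeal n d T G Q p :=
  Ideal.mem_sup_left (Ideal.mem_sup_left (Ideal.subset_span ⟨t, ht, rfl⟩))

lemma starProd_mem_starIdeal {j} (hj : j ∈ G) :
    starProd n d 0 j ∈ starIdeal (k := k) n d T G Q p :=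
  Ideal.mem_sup_left (Ideal.mem_sup_right (Ideal.subset_span ⟨j, hj, rfl⟩))

lemma prod_mem_starIdeal {J} (hJ : J ∈ powersetCard p Q) :
    ∏ j ∈ J, starProd n d 0 j ∈ starIdeal (k := k) n d T G Q p :=
  Ideal.mem_sup_right (Ideal.subset_span ⟨J, hJ, rfl⟩)

lemma starIdeal_le {I : Ideal (MvPolynomial (Fin n) k)}
    (h1 : ∀ t ∈ T, powForm n (node k t) ∈ I) (h2 : ∀ j ∈ G, starProd n d 0 j ∈ I)
    (h3 : ∀ J ∈ powersetCard p Q, ∏ j ∈ J, starProd n d 0 j ∈ I) :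
    starIdeal n d T G Q p ≤ I := by
  refine sup_le (sup_le ?_ ?_) ?_ <;> refine Ideal.span_le.2 ?_
  · rintro _ ⟨t, ht, rfl⟩; exact h1 t ht
  · rintro _ ⟨t, ht, rfl⟩; exact h2 t ht
  · rintro _ ⟨t, ht, rfl⟩; exact h3 t ht

lemma HSpans.sup_starProd {I : Ideal (MvPolynomial (Fin n) k)} {D : ℕ} (j)
    (h : ∀ l, HSpans (I ⊔ Ideal.span {powForm n (node k (j, l))}) D) :
    HSpans (I ⊔ Ideal.span {starProd n d 0 j}) (d j * D) := by
  have := HSpans.prod (range (d j)) _ (fun l => powForm_isHomogeneous (node k (j, l))) h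
  simpa [starProd] using this

lemma starProd_zero_isHomogeneous (d : Fin q ⊕ Fin s → ℕ) (j) :
    (starProd (k := k) n d 0 j).IsHomogeneous (d j) := (starProd_isTop d 0 j).1

lemma hSpans_starIdeal_of_card_eq [CharZero k] (hT : T.card + G.card = n)
    (hTG : ∀ t ∈ T, t.1 ∉ G) :
    HSpans (starIdeal (k := k) n d T G Q p) (∏ j ∈ G, d j) := by
  induction G using Finset.induction_on generalizing T with
  | empty =>
    refine HSpans.of_X_mem fun m => ?_
    refine mem_of_vandermonde_finset ((starIdeal n d T ∅ Q p).restrictScalars k) (T := T)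
      (by simpa using hT) node_injective.injOn X (fun a ha => ?_) m
    simpa [powForm, smul_eq_C_mul] using powForm_mem_starIdeal ha
  | insert g G hg ih =>
    rw [Finset.prod_insert hg]
    refine (HSpans.sup_starProd (I := starIdeal n d T G Q p) g fun l => ?_).mono ?_
    · have hnot : (g, l) ∉ T := fun h => hTG _ h (by simp)
      refine (ih (T := insert (g, l) T) ?_ ?_).mono ?_
      · rw [Finset.card_insert_of_notMem hnot]
        rw [Finset.card_insert_of_notMem hg] at hT
        omega
      · intro t ht
        rcases Finset.mem_insert.1 ht with rfl | ht
        · exact hg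
        · exact fun h => hTG t ht (by simp [h])
      · refine starIdeal_le (fun t ht => ?_)
          (fun j hj => Ideal.mem_sup_left (starProd_mem_starIdeal hj))
          (fun J hJ => Ideal.mem_sup_left (prod_mem_starIdeal hJ))
        rcases Finset.mem_insert.1 ht with rfl | ht
        · exact Ideal.mem_sup_right (Ideal.mem_span_singleton_self _)
        · exact Ideal.mem_sup_left (powForm_mem_starIdeal ht)
    · refine sup_le (starIdeal_le (fun t ht => powForm_mem_starIdeal ht)
        (fun j hj => starProd_mem_starIdeal (by simp [hj]))
        (fun J hJ => prod_mem_starIdeal hJ)) ?_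
      rw [Ideal.span_singleton_le_iff_mem]
      exact starProd_mem_starIdeal (by simp)

lemma hSpans_starIdeal [CharZero k] {N : ℕ} (hT : T.card + G.card + N = n)
    (hQ : Q.card + 1 = N + p) (hTG : ∀ t ∈ T, t.1 ∉ G) (hTQ : ∀ t ∈ T, t.1 ∉ Q)
    (hGQ : ∀ j ∈ Q, j ∉ G) :
    HSpans (starIdeal (k := k) n d T G Q p)
      ((∏ j ∈ G, d j) * ∑ J ∈ powersetCard N Q, ∏ j ∈ J, d j) := by
  induction Q using Finset.induction_on generalizing T N p with
  | empty =>
    rcases N with _ | N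
    · simpa using hSpans_starIdeal_of_card_eq (p := p) (Q := ∅) (d := d) hT hTG
    · obtain rfl : p = 0 := by simp at hQ; omega
      refine (HSpans.top _).mono ?_
      rw [top_le_iff, Ideal.eq_top_iff_one]
      simpa using prod_mem_starIdeal (k := k) (n := n) (d := d) (T := T) (G := G) (J := ∅)
        (Q := ∅) (p := 0) (by simp)
  | insert j Q hj ih =>
    rw [Finset.card_insert_of_notMem hj] at hQ
    rcases N with _ | N
    · simpa using hSpans_starIdeal_of_card_eq (p := p) (Q := insert j Q) (d := d) hT hTG
    rcases p with _ | p
    · refine (HSpans.top _).mono ?_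
      rw [top_le_iff, Ideal.eq_top_iff_one]
      simpa using prod_mem_starIdeal (k := k) (n := n) (d := d) (T := T) (G := G) (J := ∅)
        (Q := insert j Q) (p := 0) (by simp)
    have hcount : (∏ j ∈ G, d j) * ∑ J ∈ powersetCard (N + 1) (insert j Q), ∏ j ∈ J, d j =
        d j * ((∏ j ∈ G, d j) * ∑ J ∈ powersetCard N Q, ∏ j ∈ J, d j) +
          (∏ j ∈ G, d j) * ∑ J ∈ powersetCard (N + 1) Q, ∏ j ∈ J, d j := by
      rw [Finset.powersetCard_succ_insert hj, Finset.sum_union, Finset.sum_image]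
      · have : ∀ J ∈ powersetCard N Q, ∏ i ∈ insert j J, d i = d j * ∏ i ∈ J, d i := fun J hJ =>
          Finset.prod_insert fun h => hj ((Finset.mem_powersetCard.1 hJ).1 h)
        rw [Finset.sum_congr rfl this, ← Finset.mul_sum]
        ring
      · intro J hJ J' hJ' h
        have h1 : j ∉ J := fun h => hj ((Finset.mem_powersetCard.1 hJ).1 h)
        have h2 : j ∉ J' := fun h => hj ((Finset.mem_powersetCard.1 hJ').1 h)
        rw [← Finset.erase_insert h1, ← Finset.erase_insert h2, h]
      · rw [Finset.disjoint_left]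
        intro J hJ hJ'
        obtain ⟨J'', _, rfl⟩ := Finset.mem_image.1 hJ'
        exact hj ((Finset.mem_powersetCard.1 hJ).1 (by simp))
    rw [hcount]
    refine HSpans.add (starProd_zero_isHomogeneous d j) (HSpans.sup_starProd j fun l => ?_)
      (ih (T := T) (N := N + 1) (p := p) hT (by omega) hTG (fun t ht h => hTQ t ht (by simp [h]))
        (fun i hi => hGQ i (by simp [hi]))) fun f hf => ?_
    · have hnot : (j, l) ∉ T := fun h => hTQ _ h (by simp)
      refine (ih (T := insert (j, l) T) (N := N) (p := p + 1) ?_ (by omega) ?_ ?_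
        (fun i hi => hGQ i (by simp [hi]))).mono ?_
      · rw [Finset.card_insert_of_notMem hnot]
        omega
      · intro t ht
        rcases Finset.mem_insert.1 ht with rfl | ht
        · exact hGQ j (by simp)
        · exact hTG t ht
      · intro t ht
        rcases Finset.mem_insert.1 ht with rfl | ht
        · exact hj
        · exact fun h => hTQ t ht (by simp [h])
      · refine starIdeal_le (fun t ht => ?_)
          (fun j hj => Ideal.mem_sup_left (starProd_mem_starIdeal hj))
          (fun J hJ => Ideal.mem_sup_left (prod_mem_starIdeal ?_))
        · rcases Finset.mem_insert.1 ht with rfl | ht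
          · exact Ideal.mem_sup_right (Ideal.mem_span_singleton_self _)
          · exact Ideal.mem_sup_left (powForm_mem_starIdeal ht)
        · exact Finset.powersetCard_mono (Finset.subset_insert _ _) hJ
    · have hle : starIdeal n d T G Q p ≤
          Submodule.comap (LinearMap.mulLeft (MvPolynomial (Fin n) k) (starProd n d 0 j))
            (starIdeal n d T G (insert j Q) (p + 1)) := by
        refine starIdeal_le (fun t ht => ?_) (fun i hi => ?_) (fun J hJ => ?_)
        · exact Ideal.mul_mem_left _ _ (powForm_mem_starIdeal ht)
        · exact Ideal.mul_mem_left _ _ (starProd_mem_starIdeal hi)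
        · obtain ⟨h1, h2⟩ := Finset.mem_powersetCard.1 hJ
          have h3 : j ∉ J := fun h => hj (h1 h)
          have := prod_mem_starIdeal (k := k) (n := n) (d := d) (T := T) (G := G)
            (Q := insert j Q) (p := p + 1) (J := insert j J) (Finset.mem_powersetCard.2
              ⟨Finset.insert_subset_insert _ h1, by rw [Finset.card_insert_of_notMem h3, h2]⟩)
          rw [Finset.prod_insert h3] at this
          exact this
      exact hle hf

/-- The bound for the dimension of the quotient by a determinantal ideal. -/
def detBound (p : ℕ) (d : Fin q ⊕ Fin s → ℕ) : ℕ :=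
  (∏ i, d (Sum.inr i)) * ∑ J ∈ powersetCard (q + 1 - p) univ, ∏ j ∈ J, d (Sum.inl j)

/-- The homogeneous star system has a homogeneous spanning set of the expected size. -/
lemma hSpans_star [CharZero k] (hpq : p ≤ q) (hn : n + p = q + s + 1) (d : Fin q ⊕ Fin s → ℕ) :
    HSpans (sysIdeal (starMat (k := k) p n d 0) (starEqs n d 0)) (detBound p d) := by
  have h := hSpans_starIdeal (k := k) (n := n) (d := d) (T := ∅)
    (G := univ.map Function.Embedding.inr) (Q := univ.map Function.Embedding.inl)
    (p := p) (N := q + 1 - p) (by simp; omega) (by simp; omega) (by simp) (by simp) (by simp)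
  have hcount : (∏ j ∈ (univ : Finset (Fin s)).map Function.Embedding.inr, d j) *
      ∑ J ∈ powersetCard (q + 1 - p) ((univ : Finset (Fin q)).map Function.Embedding.inl),
        ∏ j ∈ J, d j = detBound p d := by
    rw [detBound, Finset.powersetCard_map]
    simp
  rw [hcount] at h
  refine h.mono (starIdeal_le (by simp) ?_ ?_)
  · intro j hj
    obtain ⟨i, _, rfl⟩ := Finset.mem_map.1 hj
    exact sysGen_mem (starMat p n d 0) (starEqs n d 0) (Sum.inr i)
  · intro J hJ
    rw [Finset.powersetCard_map] at hJ
    obtain ⟨J, hJ', rfl⟩ := Finset.mem_map.1 hJ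
    have := prod_starProd_mem_sysIdeal (k := k) (n := n) d 0 (Finset.mem_powersetCard.1 hJ').2
    simpa using this

end Star

section Start

variable {k : Type*} [Field k] {p q s n : ℕ}

/-- The constants of the start system: the affine factors are `powForm n θ + θ ^ n`. -/
def startConst (n : ℕ) (a : (Fin q ⊕ Fin s) × ℕ) : k := -(node k a) ^ n

/-- The coefficient vector of the monic polynomial whose roots are the nodes of `T`. -/
noncomputable def nodePoint (k : Type*) [Field k] (n : ℕ) (T : Finset ((Fin q ⊕ Fin s) × ℕ)) :
    Fin n → k :=
  fun m => (∏ t ∈ T, (Polynomial.X - Polynomial.C (node k t))).coeff m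

lemma eval_nodePoint {T : Finset ((Fin q ⊕ Fin s) × ℕ)} (hT : T.card = n) (θ : k) :
    eval (nodePoint k n T) (powForm n θ) + θ ^ n = ∏ t ∈ T, (θ - node k t) := by
  have h1 : (∏ t ∈ T, (Polynomial.X - Polynomial.C (node k t))).natDegree = n := by
    rw [Polynomial.natDegree_prod_of_monic _ _ fun t _ => Polynomial.monic_X_sub_C _]
    simp [hT]
  have h2 := Polynomial.monic_prod_of_monic T _ fun t _ => Polynomial.monic_X_sub_C (node k t)
  have h3 := Polynomial.eval_eq_sum_range (p := ∏ t ∈ T, (Polynomial.X - Polynomial.C (node k t))) θ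
  have h4 : (∏ t ∈ T, (Polynomial.X - Polynomial.C (node k t))).coeff n = 1 := by
    conv_lhs => rw [← h1]
    exact h2
  rw [h1, Finset.sum_range_succ, h4, one_mul, Finset.sum_range] at h3
  simp only [Polynomial.eval_prod, Polynomial.eval_sub, Polynomial.eval_X,
    Polynomial.eval_C] at h3
  rw [h3]
  simp [powForm, nodePoint, mul_comm]

lemma eval_nodePoint_eq_zero_iff [CharZero k] {T : Finset ((Fin q ⊕ Fin s) × ℕ)}
    (hT : T.card = n) (a) :
    eval (nodePoint k n T) (powForm n (node k a)) + node k a ^ n = 0 ↔ a ∈ T := by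
  rw [eval_nodePoint hT, Finset.prod_eq_zero_iff]
  constructor
  · rintro ⟨t, ht, h⟩
    rwa [node_injective (sub_eq_zero.1 h)]
  · exact fun h => ⟨a, h, sub_self _⟩

/-- The choices of `q + 1 - p` columns and of one linear factor in each of these columns and in
each additional equation. -/
def choices (p : ℕ) (d : Fin q ⊕ Fin s → ℕ) :
    Finset (Σ _ : Finset (Fin q), Fin q ⊕ Fin s → ℕ) :=
  (powersetCard (q + 1 - p) univ).sigma fun J =>
    Fintype.piFinset fun j => if j ∈ J.disjSum univ then range (d j) else {0}

lemma card_choices (d : Fin q ⊕ Fin s → ℕ) : (choices p d).card = detBound p d := by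
  rw [choices, Finset.card_sigma, detBound, Finset.mul_sum]
  refine Finset.sum_congr rfl fun J _ => ?_
  rw [Fintype.card_piFinset]
  simp only [apply_ite Finset.card, Finset.card_range, Finset.card_singleton]
  rw [Finset.prod_ite_mem, Finset.univ_inter, Finset.prod_disjSum, mul_comm]

/-- The linear factors selected by a choice. -/
def choiceNodes (ω : Σ _ : Finset (Fin q), Fin q ⊕ Fin s → ℕ) : Finset ((Fin q ⊕ Fin s) × ℕ) :=
  (ω.1.disjSum univ).image fun j => (j, ω.2 j)

lemma mem_choiceNodes {ω : Σ _ : Finset (Fin q), Fin q ⊕ Fin s → ℕ} {j l} :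
    (j, l) ∈ choiceNodes ω ↔ j ∈ ω.1.disjSum univ ∧ ω.2 j = l := by
  simp only [choiceNodes, Finset.mem_image, Prod.mk.injEq]
  constructor
  · rintro ⟨_, h, rfl, h'⟩
    exact ⟨h, h'⟩
  · rintro ⟨h, h'⟩
    exact ⟨j, h, rfl, h'⟩

lemma card_choiceNodes (hpq : p ≤ q) (hn : n + p = q + s + 1) {d : Fin q ⊕ Fin s → ℕ} {ω}
    (hω : ω ∈ choices p d) : (choiceNodes ω).card = n := by
  rw [choices, Finset.mem_sigma, Finset.mem_powersetCard] at hω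
  rw [choiceNodes, Finset.card_image_of_injective _ fun a b h => (Prod.mk.inj h).1,
    Finset.card_disjSum, hω.1.2]
  simp
  omega

lemma choiceNodes_injOn (d : Fin q ⊕ Fin s → ℕ) :
    Set.InjOn choiceNodes (choices p d : Set (Σ _ : Finset (Fin q), Fin q ⊕ Fin s → ℕ)) := by
  rintro ⟨J, f⟩ hω ⟨J', f'⟩ hω' h
  have hJ : J = J' := by
    ext j
    have h1 : (∃ l, (Sum.inl j, l) ∈ choiceNodes (s := s) ⟨J, f⟩) ↔ j ∈ J := by
      simp [mem_choiceNodes]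
    have h2 : (∃ l, (Sum.inl j, l) ∈ choiceNodes (s := s) ⟨J', f'⟩) ↔ j ∈ J' := by
      simp [mem_choiceNodes]
    rw [← h1, ← h2, h]
  subst hJ
  congr 1
  funext j
  by_cases hj : j ∈ J.disjSum univ
  · have : (j, f j) ∈ choiceNodes ⟨J, f'⟩ := by
      rw [← h, mem_choiceNodes]
      exact ⟨hj, rfl⟩
    exact (mem_choiceNodes.1 this).2.symm
  · simp only [choices, Finset.coe_sigma, Set.mem_sigma_iff, Finset.mem_coe,
      Fintype.mem_piFinset] at hω hω'
    have h1 := hω.2 j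
    have h2 := hω'.2 j
    rw [if_neg hj, Finset.mem_singleton] at h1 h2
    rw [h1, h2]

lemma nodePoint_choiceNodes_injOn [CharZero k] (hpq : p ≤ q) (hn : n + p = q + s + 1)
    (d : Fin q ⊕ Fin s → ℕ) :
    Function.Injective fun ω : choices p d => nodePoint k n (choiceNodes ω.1) := by
  intro ω ω' h
  refine Subtype.ext (choiceNodes_injOn d ω.2 ω'.2 ?_)
  ext a
  rw [← eval_nodePoint_eq_zero_iff (k := k) (card_choiceNodes hpq hn ω.2),
    ← eval_nodePoint_eq_zero_iff (k := k) (card_choiceNodes hpq hn ω'.2)]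
  simp only at h
  rw [h]

lemma eval_starProd_start {d : Fin q ⊕ Fin s → ℕ} {x : Fin n → k} {j l} (hl : l < d j)
    (h : eval x (powForm n (node k (j, l))) + node k (j, l) ^ n = 0) :
    eval x (starProd n d (startConst n) j) = 0 := by
  rw [starProd, eval_prod]
  refine Finset.prod_eq_zero (Finset.mem_range.2 hl) ?_
  simpa [startConst] using h

lemma eval_nodePoint_of_mem_sysIdeal [CharZero k] (hpq : p ≤ q) (hn : n + p = q + s + 1)
    {d : Fin q ⊕ Fin s → ℕ} {ω} (hω : ω ∈ choices p d) {f : MvPolynomial (Fin n) k}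
    (hf : f ∈ sysIdeal (starMat p n d (startConst n)) (starEqs n d (startConst n))) :
    eval (nodePoint k n (choiceNodes ω)) f = 0 := by
  have hT := card_choiceNodes hpq hn hω
  rw [choices, Finset.mem_sigma, Finset.mem_powersetCard, Fintype.mem_piFinset] at hω
  have key : ∀ j ∈ ω.1.disjSum univ,
      eval (nodePoint k n (choiceNodes ω)) (starProd n d (startConst n) j) = 0 := by
    intro j hj
    have h1 := hω.2 j
    rw [if_pos hj, Finset.mem_range] at h1
    exact eval_starProd_start h1
      ((eval_nodePoint_eq_zero_iff hT _).2 (mem_choiceNodes.2 ⟨hj, rfl⟩))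
  rw [← RingHom.mem_ker]
  refine (Ideal.span_le.2 ?_ : sysIdeal _ _ ≤ RingHom.ker (eval _)) hf
  rintro _ ⟨e | i, rfl⟩
  · have : ∃ i, e i ∈ ω.1 := by
      by_contra! hc
      have h1 : Disjoint ω.1 (univ.map e) := by
        rw [Finset.disjoint_right]
        intro x hx
        obtain ⟨i, _, rfl⟩ := Finset.mem_map.1 hx
        exact hc i
      have h2 := Finset.card_le_univ (ω.1 ∪ univ.map e)
      rw [Finset.card_union_of_disjoint h1, hω.1.2, Finset.card_map] at h2
      simp at h2
      omega
    obtain ⟨i, hi⟩ := this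
    simp only [sysGen, Sum.elim_inl, starMat_minor, SetLike.mem_coe, RingHom.mem_ker, map_mul,
      eval_prod]
    rw [Finset.prod_eq_zero (Finset.mem_univ i) (key _ (by simpa using hi)), mul_zero]
  · exact key (Sum.inr i) (by simp)

lemma exists_eval_eq {ι σ : Type*} [Fintype ι] {P : ι → σ → k}
    (hP : Function.Injective P) (y : ι → k) : ∃ f : MvPolynomial σ k, ∀ ω, eval (P ω) f = y ω := by
  classical
  have h : ∀ ω ω', ω' ≠ ω → ∃ f : MvPolynomial σ k, eval (P ω) f = 1 ∧ eval (P ω') f = 0 := by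
    intro ω ω' hne
    obtain ⟨v, hv⟩ := Function.ne_iff.1 (hP.ne hne)
    refine ⟨C (P ω v - P ω' v)⁻¹ * (X v - C (P ω' v)), ?_, by simp⟩
    simp [inv_mul_cancel₀ (sub_ne_zero.2 hv.symm)]
  choose! L hL1 hL0 using h
  refine ⟨∑ ω, C (y ω) * ∏ ω' ∈ univ.erase ω, L ω ω', fun ω => ?_⟩
  simp only [eval_sum, eval_mul, eval_C, eval_prod]
  rw [Finset.sum_eq_single ω]
  · rw [Finset.prod_eq_one fun ω' h => hL1 _ _ (Finset.ne_of_mem_erase h), mul_one]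
  · intro ω' _ hne
    rw [Finset.prod_eq_zero (Finset.mem_erase.2 ⟨hne.symm, Finset.mem_univ ω⟩)
      (hL0 _ _ hne.symm), mul_zero]
  · simp

/-- A spanning set of the expected size is linearly independent modulo the start system. -/
lemma start_independent [CharZero k] (hpq : p ≤ q) (hn : n + p = q + s + 1)
    {d : Fin q ⊕ Fin s → ℕ} {B : Fin (detBound p d) → MvPolynomial (Fin n) k}
    (hB : SpansMod B (sysIdeal (starMat p n d (startConst n)) (starEqs n d (startConst n))))
    {r : Fin (detBound p d) → k}
    (hr : ∑ i, C (r i) * B i ∈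
      sysIdeal (starMat p n d (startConst n)) (starEqs n d (startConst n))) : r = 0 := by
  let P := fun ω : choices p d => nodePoint k n (choiceNodes ω.1)
  let L : (Fin (detBound p d) → k) →ₗ[k] (choices p d → k) :=
    LinearMap.pi fun ω => ∑ i, (eval (P ω) (B i)) • LinearMap.proj i
  have hL : ∀ r ω, L r ω = eval (P ω) (∑ i, C (r i) * B i) := by
    intro r ω
    simp [L, mul_comm]
  have hsurj : Function.Surjective L := by
    intro y
    obtain ⟨f, hf⟩ := exists_eval_eq (nodePoint_choiceNodes_injOn (k := k) hpq hn d) y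
    obtain ⟨r, hr⟩ := hB f
    refine ⟨r, funext fun ω => ?_⟩
    rw [hL, ← hf, eq_comm, ← sub_eq_zero, ← map_sub]
    exact eval_nodePoint_of_mem_sysIdeal hpq hn ω.2 hr
  have hinj : Function.Injective L :=
    (LinearMap.injective_iff_surjective_of_finrank_eq_finrank (by simp [card_choices])).2 hsurj
  refine hinj (funext fun ω => ?_)
  rw [hL, map_zero]
  exact eval_nodePoint_of_mem_sysIdeal hpq hn ω.2 hr

end Start

section LocalAlgebra

lemma height_of_isMaximal {k : Type*} [Field k] (n : ℕ)
    (𝔪 : Ideal (MvPolynomial (Fin n) (Polynomial k))) [𝔪.IsMaximal] : 𝔪.height = n + 1 := by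
  induction n with
  | zero =>
    let e := (isEmptyRingEquiv (Polynomial k) (Fin 0)).symm
    have : (𝔪.comap e).IsMaximal := Ideal.comap_isMaximal_of_equiv e
    rw [← RingEquiv.height_comap e,
      IsPrincipalIdealRing.height_eq_one_of_isMaximal _ (Polynomial.not_isField k)]
    simp
  | succ n ih =>
    let e := (finSuccEquiv (Polynomial k) n).toRingEquiv.symm
    rw [← RingEquiv.height_comap (R := Polynomial (MvPolynomial (Fin n) (Polynomial k))) e]
    have hPmax : (𝔪.comap e).IsMaximal := Ideal.comap_isMaximal_of_equiv e
    generalize 𝔪.comap e = P at *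
    have hmax := Polynomial.isMaximal_comap_C_of_isJacobsonRing P
    have : P.LiesOver (P.comap Polynomial.C) := ⟨rfl⟩
    rw [Polynomial.height_eq_height_add_one (P.comap Polynomial.C) P, ih]
    push_cast
    rfl

lemma isNilpotent_of_maximalIdeal_eq_span {B : Type*} [CommRing B] [IsNoetherianRing B]
    [IsLocalRing B] {u z : B} (hu : IsLocalRing.maximalIdeal B = Ideal.span {u}) (hz : z ≠ 0)
    (huz : u * z = 0) : IsNilpotent u := by
  classical
  have hex : ∃ i, z ∉ Ideal.span {u} ^ i := by
    by_contra! hc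
    have h1 := Ideal.iInf_pow_eq_bot_of_isLocalRing (Ideal.span {u})
      (hu ▸ Ideal.IsPrime.ne_top')
    exact hz (by simpa [h1] using (Ideal.mem_iInf (I := fun i => Ideal.span {u} ^ i)).2 hc)
  obtain ⟨i, hi⟩ : ∃ i, Nat.find hex = i + 1 :=
    Nat.exists_eq_succ_of_ne_zero fun h => by simpa [h] using Nat.find_spec hex
  have h1 : z ∉ Ideal.span {u} ^ (i + 1) := hi ▸ Nat.find_spec hex
  have h2 : z ∈ Ideal.span {u} ^ i := not_not.1 (Nat.find_min hex (by omega))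
  rw [Ideal.span_singleton_pow, Ideal.mem_span_singleton'] at h1 h2
  obtain ⟨c, rfl⟩ := h2
  have hc : IsUnit c := by
    by_contra hc
    have h3 : c ∈ IsLocalRing.maximalIdeal B := hc
    rw [hu, Ideal.mem_span_singleton'] at h3
    obtain ⟨b, rfl⟩ := h3
    exact h1 ⟨b, by ring⟩
  refine ⟨i + 1, ?_⟩
  rw [← hc.mul_right_eq_zero, ← huz]
  ring

/-- If `u` is a uniformizer locally at `𝔪` modulo `I` and does not vanish identically on
`V(I)` near `𝔪`, then `u` is not a zero divisor locally at `𝔪` modulo `I`. -/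
lemma exists_notMem_mul_mem {A : Type*} [CommRing A] [IsNoetherianRing A] {I 𝔪 𝔭 : Ideal A}
    [𝔪.IsMaximal] [𝔭.IsPrime] (hI : I ≤ 𝔭) (h𝔭 : 𝔭 ≤ 𝔪) {u z : A} (hu : u ∈ 𝔪) (hu𝔭 : u ∉ 𝔭)
    (hm : ∀ a ∈ 𝔪, ∃ r ∉ 𝔪, r * a ∈ I ⊔ Ideal.span {u}) (huz : u * z ∈ I) :
    ∃ r ∉ 𝔪, r * z ∈ I := by
  let L := Localization.AtPrime 𝔪
  let f := algebraMap A L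
  by_contra! hz
  have hmem : ∀ x, f x ∈ I.map f ↔ ∃ r ∉ 𝔪, r * x ∈ I := fun x =>
    IsLocalization.algebraMap_mem_map_algebraMap_iff 𝔪.primeCompl L I x
  have htop : I.map f ≠ ⊤ := fun h => by
    obtain ⟨r, hr, hr'⟩ := (hmem 1).1 (h ▸ trivial)
    rw [mul_one] at hr'
    exact hr (h𝔭 (hI hr'))
  let π := Ideal.Quotient.mk (I.map f)
  have : Nontrivial (L ⧸ I.map f) := Ideal.Quotient.nontrivial_iff.2 htop
  have : IsLocalRing (L ⧸ I.map f) := IsLocalRing.of_surjective' π Ideal.Quotient.mk_surjective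
  have : IsLocalHom π := IsLocalHom.of_surjective π Ideal.Quotient.mk_surjective
  have hmax : IsLocalRing.maximalIdeal (L ⧸ I.map f) = Ideal.span {π (f u)} := by
    apply le_antisymm
    · intro x hx
      obtain ⟨y, rfl⟩ := Ideal.Quotient.mk_surjective x
      have hy : y ∈ IsLocalRing.maximalIdeal L := fun h => hx (h.map π)
      rw [← Localization.AtPrime.map_eq_maximalIdeal] at hy
      have hle : 𝔪.map f ≤ (Ideal.span {π (f u)}).comap π := by
        rw [Ideal.map_le_iff_le_comap]
        intro a ha
        obtain ⟨r, hr, hra⟩ := hm a ha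
        have h1 : π (f (r * a)) ∈ Ideal.span {π (f u)} := by
          obtain ⟨b, hb, c, hc, hbc⟩ := Submodule.mem_sup.1 hra
          obtain ⟨e, rfl⟩ := Ideal.mem_span_singleton'.1 hc
          rw [← hbc, map_add, map_add, Ideal.Quotient.eq_zero_iff_mem.2 (Ideal.mem_map_of_mem f hb),
            zero_add, map_mul, map_mul]
          exact Ideal.mul_mem_left _ _ (Ideal.mem_span_singleton_self _)
        rw [map_mul, map_mul] at h1
        have h2 : IsUnit (π (f r)) :=
          (IsLocalization.map_units L (⟨r, hr⟩ : 𝔪.primeCompl)).map π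
        exact (Ideal.unit_mul_mem_iff_mem _ h2).1 h1
      exact hle hy
    · rw [Ideal.span_singleton_le_iff_mem, IsLocalRing.mem_maximalIdeal, mem_nonunits_iff]
      intro h
      have hmap := (isUnit_of_map_unit π _ h)
      have h3 : f u ∈ IsLocalRing.maximalIdeal L := by
        rw [← Localization.AtPrime.map_eq_maximalIdeal]
        exact Ideal.mem_map_of_mem _ hu
      exact h3 hmap
  obtain ⟨i, hi⟩ := isNilpotent_of_maximalIdeal_eq_span (z := π (f z)) hmax
    (fun h => by
      obtain ⟨r, hr, hr'⟩ := (hmem z).1 (Ideal.Quotient.eq_zero_iff_mem.1 h)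
      exact hz r hr hr')
    (by
      rw [← map_mul, ← map_mul]
      exact Ideal.Quotient.eq_zero_iff_mem.2 (Ideal.mem_map_of_mem f huz))
  rw [← map_pow, ← map_pow] at hi
  obtain ⟨r, hr, hr'⟩ := (hmem _).1 (Ideal.Quotient.eq_zero_iff_mem.1 hi)
  rcases Ideal.IsPrime.mem_or_mem ‹𝔭.IsPrime› (hI hr') with h | h
  · exact hr (h𝔭 h)
  · exact hu𝔭 (Ideal.IsPrime.mem_of_pow_mem ‹_› _ h)

end LocalAlgebra

section Cofactor

variable {A : Type*} [CommRing A] {p q : ℕ}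

/-- The cofactors of the first column of a matrix whose remaining columns are given by `M`. -/
def cofactors (M : Matrix (Fin (p + 1)) (Fin p) A) (r : Fin (p + 1)) : A :=
  (-1) ^ (r : ℕ) * (M.submatrix r.succAbove id).det

/-- The square matrix with first column `z` and remaining columns given by `M`. -/
def consCol (z : Fin (p + 1) → A) (M : Matrix (Fin (p + 1)) (Fin p) A) :
    Matrix (Fin (p + 1)) (Fin (p + 1)) A :=
  Matrix.of fun i => Fin.cons (z i) (M i)

lemma cofactors_dotProduct (M : Matrix (Fin (p + 1)) (Fin p) A) (z : Fin (p + 1) → A) :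
    cofactors M ⬝ᵥ z = (consCol z M).det := by
  rw [Matrix.det_succ_column_zero, dotProduct]
  refine Finset.sum_congr rfl fun i _ => ?_
  have : (consCol z M).submatrix i.succAbove Fin.succ = M.submatrix i.succAbove id := by
    ext a b; simp [consCol]
  rw [this]
  simp [cofactors, consCol]
  ring

/-- If the cofactor functional of some columns of `F` is nonzero modulo a prime and vanishes on
all columns, then all maximal minors vanish. -/
lemma minor_mem_of_cofactors {𝔭 : Ideal A} [𝔭.IsPrime] {F : Matrix (Fin (p + 1)) (Fin q) A}
    {y w : Fin (p + 1) → A} (hw : y ⬝ᵥ w ∉ 𝔭) (hy : ∀ j, (y ⬝ᵥ fun i => F i j) ∈ 𝔭)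
    (e : Fin (p + 1) → Fin q) : (F.submatrix id e).det ∈ 𝔭 := by
  let π := Ideal.Quotient.mk 𝔭
  rw [← Ideal.Quotient.eq_zero_iff_mem, RingHom.map_det, RingHom.mapMatrix_apply,
    ← Matrix.exists_vecMul_eq_zero_iff]
  refine ⟨fun i => π (y i), fun h => hw ?_, ?_⟩
  · rw [← Ideal.Quotient.eq_zero_iff_mem, dotProduct, map_sum]
    refine Finset.sum_eq_zero fun i _ => ?_
    rw [map_mul]
    have := congrFun h i
    simp only [Pi.zero_apply] at this
    change π (y i) * _ = 0
    rw [this, zero_mul]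
  · funext j
    have := Ideal.Quotient.eq_zero_iff_mem.2 (hy (e j))
    simpa [Matrix.vecMul, dotProduct, π] using this

end Cofactor

section StartLocal

variable {k : Type*} [Field k] {p q s n : ℕ}

/-- The affine linear factors of the start system. -/
noncomputable def startFactor (k : Type*) [Field k] (n : ℕ) (a : (Fin q ⊕ Fin s) × ℕ) :
    MvPolynomial (Fin n) k :=
  powForm n (node k a) - C (startConst n a)

lemma card_le_of_startFactor_mem [CharZero k] {𝔫 : Ideal (MvPolynomial (Fin n) k)} (h𝔫 : 𝔫 ≠ ⊤)
    {T : Finset ((Fin q ⊕ Fin s) × ℕ)} (hT : ∀ a ∈ T, startFactor k n a ∈ 𝔫) : T.card ≤ n := by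
  by_contra! hc
  obtain ⟨T', hT', hcard⟩ := Finset.exists_subset_card_eq (Nat.succ_le_of_lt hc)
  have := mem_of_vandermonde_finset (𝔫.restrictScalars k) hcard node_injective.injOn
    (Fin.snoc (fun m : Fin n => (X m : MvPolynomial (Fin n) k)) 1 : Fin (n + 1) → _)
    (fun a ha => ?_) (Fin.last n)
  · exact h𝔫 ((Ideal.eq_top_iff_one _).2 (by simpa using this))
  · rw [Fin.sum_univ_castSucc]
    simpa [startFactor, powForm, smul_eq_C_mul, startConst] using hT a (hT' ha)

lemma sub_C_eval_nodePoint_mem [CharZero k] {T : Finset ((Fin q ⊕ Fin s) × ℕ)} (hT : T.card = n)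
    (f : MvPolynomial (Fin n) k) :
    f - C (eval (nodePoint k n T) f) ∈
      Ideal.span (startFactor k n '' (T : Set ((Fin q ⊕ Fin s) × ℕ))) := by
  set I := Ideal.span (startFactor k n '' (T : Set ((Fin q ⊕ Fin s) × ℕ)))
  have hX : ∀ m, X m - C (nodePoint k n T m) ∈ I := by
    refine mem_of_vandermonde_finset (I.restrictScalars k) hT node_injective.injOn _
      fun a ha => ?_
    have h1 : startFactor k n a ∈ I := Ideal.subset_span ⟨a, ha, rfl⟩
    have h2 := (eval_nodePoint_eq_zero_iff (k := k) hT a).2 ha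
    have h3 : startConst n a = eval (nodePoint k n T) (powForm n (node k a)) := by
      rw [startConst]
      linear_combination -h2
    rw [startFactor, h3] at h1
    convert! h1 using 1
    simp [powForm, smul_eq_C_mul, mul_sub, Finset.sum_sub_distrib]
  induction f using MvPolynomial.induction_on with
  | C a => simp
  | add f g hf hg =>
    convert! I.add_mem hf hg using 1
    simp only [map_add]
    ring
  | mul_X f i hf =>
    convert! I.add_mem (I.mul_mem_left f (hX i)) (I.mul_mem_left (C (nodePoint k n T i)) hf) using 1
    simp only [map_mul, eval_X]
    ring

lemma exists_startFactor_mem {d : Fin q ⊕ Fin s → ℕ} {𝔫 : Ideal (MvPolynomial (Fin n) k)}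
    [𝔫.IsPrime] {j} (hj : starProd n d (startConst n) j ∈ 𝔫) :
    ∃ l < d j, startFactor k n (j, l) ∈ 𝔫 := by
  obtain ⟨l, hl, h⟩ := (Ideal.IsPrime.prod_mem_iff (p := 𝔫)).1 hj
  exact ⟨l, Finset.mem_range.1 hl, h⟩

/-- The start system is reduced at each of its zeros, and at such a zero exactly `q + 1 - p` of
the columns vanish. -/
lemma start_local [CharZero k] (hn : n + p = q + s + 1) {d : Fin q ⊕ Fin s → ℕ}
    {𝔫 : Ideal (MvPolynomial (Fin n) k)} [𝔫.IsPrime]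
    (hS : sysIdeal (starMat p n d (startConst n)) (starEqs n d (startConst n)) ≤ 𝔫) :
    ∃ Z : Finset (Fin q), Z.card + p = q + 1 ∧
      (∀ j ∉ Z, starProd n d (startConst n) (Sum.inl j) ∉ 𝔫) ∧
      ∀ f ∈ 𝔫, ∃ r ∉ 𝔫, r * f ∈ sysIdeal (starMat p n d (startConst n))
        (starEqs n d (startConst n)) := by
  classical
  set S : Ideal (MvPolynomial (Fin n) k) :=
    sysIdeal (starMat p n d (startConst n)) (starEqs n d (startConst n))
  let φ := starProd (k := k) n d (startConst n)
  let Z : Finset (Fin q) := {j | φ (Sum.inl j) ∈ 𝔫}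
  have hZc : (Zᶜ).card < p := by
    by_contra! hc
    obtain ⟨J, hJ, hcard⟩ := Finset.exists_subset_card_eq hc
    obtain ⟨j, hj, hj'⟩ := (Ideal.IsPrime.prod_mem_iff (p := 𝔫)).1
      (hS (prod_starProd_mem_sysIdeal d (startConst n) hcard))
    have := hJ hj
    simp only [Z, Finset.mem_compl, Finset.mem_filter, Finset.mem_univ, true_and] at this
    exact this hj'
  have hφ : ∀ j ∈ Z.disjSum (univ : Finset (Fin s)), φ j ∈ 𝔫 := by
    rintro (j | i) hj
    · simpa [Z] using hj
    · exact hS (sysGen_mem (starMat p n d (startConst n)) (starEqs n d (startConst n)) (Sum.inr i))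
  choose! l hl hl' using fun j hj => exists_startFactor_mem (hφ j hj)
  set T := (Z.disjSum (univ : Finset (Fin s))).image fun j => (j, l j) with hT
  have hTmem : ∀ a ∈ T, startFactor k n a ∈ 𝔫 := by
    intro a ha
    obtain ⟨j, hj, rfl⟩ := Finset.mem_image.1 ha
    exact hl' j hj
  have hTcard : T.card = Z.card + s := by
    rw [hT, Finset.card_image_of_injective _ fun a b h => (Prod.mk.inj h).1]
    simp
  have hle := card_le_of_startFactor_mem (Ideal.IsPrime.ne_top ‹_›) hTmem
  have hZ : Z.card + p = q + 1 := by
    rw [Finset.card_compl, Fintype.card_fin] at hZc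
    have := Finset.card_le_univ Z
    rw [Fintype.card_fin] at this
    omega
  have huniq : ∀ j ∈ Z.disjSum (univ : Finset (Fin s)), ∀ l', l' ≠ l j →
      startFactor k n (j, l') ∉ 𝔫 := by
    intro j hj l' hne hmem
    have hnot : (j, l') ∉ T := by
      intro h
      obtain ⟨j', _, h'⟩ := Finset.mem_image.1 h
      obtain ⟨rfl, rfl⟩ := Prod.mk.inj h'
      exact hne rfl
    have := card_le_of_startFactor_mem (Ideal.IsPrime.ne_top ‹𝔫.IsPrime›) (T := insert (j, l') T)
      (fun a ha => by
        rcases Finset.mem_insert.1 ha with rfl | ha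
        · exact hmem
        · exact hTmem a ha)
    rw [Finset.card_insert_of_notMem hnot] at this
    omega
  have hfac : ∀ j ∈ Z.disjSum (univ : Finset (Fin s)),
      ∃ r ∉ 𝔫, φ j = r * startFactor k n (j, l j) := by
    intro j hj
    refine ⟨∏ l' ∈ (range (d j)).erase (l j), startFactor k n (j, l'), ?_, ?_⟩
    · rw [Ideal.IsPrime.prod_mem_iff]
      rintro ⟨l', hl', h⟩
      exact huniq j hj l' (Finset.ne_of_mem_erase hl') h
    · exact (Finset.prod_erase_mul _ _ (Finset.mem_range.2 (hl j hj))).symm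
  have hsat : ∀ a ∈ T, ∃ r ∉ 𝔫, r * startFactor k n a ∈ S := by
    intro a ha
    obtain ⟨j, hj, rfl⟩ := Finset.mem_image.1 ha
    obtain ⟨r, hr, hφr⟩ := hfac j hj
    rcases j with j | i
    · have hjZ : j ∉ Zᶜ := by simpa using hj
      refine ⟨(∏ i ∈ Zᶜ, φ (Sum.inl i)) * r, ?_, ?_⟩
      · refine Ideal.IsPrime.mul_notMem ‹_› ?_ hr
        rw [Ideal.IsPrime.prod_mem_iff]
        rintro ⟨i, hi, h⟩
        simp [Z] at hi
        exact hi h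
      · have := prod_starProd_mem_sysIdeal (k := k) (n := n) (p := p) d (startConst n)
          (J := insert j Zᶜ) (by
            rw [Finset.card_insert_of_notMem hjZ, Finset.card_compl, Fintype.card_fin]
            omega)
        rw [Finset.prod_insert hjZ] at this
        rw [mul_assoc, ← hφr, mul_comm]
        exact this
    · refine ⟨r, hr, ?_⟩
      rw [← hφr]
      exact sysGen_mem (starMat p n d (startConst n)) (starEqs n d (startConst n)) (Sum.inr i)
  refine ⟨Z, hZ, fun j hj => by simpa [Z] using hj, fun f hf => ?_⟩
  let L := Localization.AtPrime 𝔫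
  have hmem : ∀ x, algebraMap _ L x ∈ S.map (algebraMap _ L) ↔ ∃ r ∉ 𝔫, r * x ∈ S := fun x =>
    IsLocalization.algebraMap_mem_map_algebraMap_iff 𝔫.primeCompl L S x
  have hspan : Ideal.span (startFactor k n '' (T : Set ((Fin q ⊕ Fin s) × ℕ))) ≤
      (S.map (algebraMap _ L)).comap (algebraMap _ L) := by
    rw [Ideal.span_le]
    rintro _ ⟨a, ha, rfl⟩
    exact (hmem _).2 (hsat a ha)
  have hspan' : Ideal.span (startFactor k n '' (T : Set ((Fin q ⊕ Fin s) × ℕ))) ≤ 𝔫 := by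
    rw [Ideal.span_le]
    rintro _ ⟨a, ha, rfl⟩
    exact hTmem a ha
  have hf1 := sub_C_eval_nodePoint_mem (k := k) (T := T) (by omega) f
  have hf2 : C (eval (nodePoint k n T) f) ∈ 𝔫 := by
    have := 𝔫.sub_mem hf (hspan' hf1)
    simpa using this
  have hf3 : eval (nodePoint k n T) f = 0 := by
    by_contra hne
    exact Ideal.IsPrime.ne_top ‹𝔫.IsPrime› (Ideal.eq_top_of_isUnit_mem _ hf2
      ((isUnit_iff_ne_zero.2 hne).map C))
  rw [hf3, C_0, sub_zero] at hf1
  exact (hmem f).1 (hspan hf1)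

end StartLocal

section Krull

variable {k : Type*} [Field k] {p q s n : ℕ}

/-- A determinantal system in `n + 1` dimensional space has no isolated zeros at which a
submaximal minor is nonzero. -/
lemma exists_prime_lt {𝔪 : Ideal (MvPolynomial (Fin n) (Polynomial k))} [𝔪.IsMaximal]
    {F : Matrix (Fin (p + 1)) (Fin q) (MvPolynomial (Fin n) (Polynomial k))}
    {g : Fin s → MvPolynomial (Fin n) (Polynomial k)} (hI : sysIdeal F g ≤ 𝔪)
    (Z : Finset (Fin q)) (hZ : Z.card + s = n) {e : Fin p ↪ Fin q} (he : ∀ j ∉ Z, ∃ i, e i = j)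
    {w : Fin (p + 1) → MvPolynomial (Fin n) (Polynomial k)}
    (hw : (consCol w (F.submatrix id e)).det ∉ 𝔪) :
    ∃ 𝔭 : Ideal (MvPolynomial (Fin n) (Polynomial k)), 𝔭.IsPrime ∧ sysIdeal F g ≤ 𝔭 ∧ 𝔭 < 𝔪 := by
  classical
  set y := cofactors (F.submatrix id e) with hy
  have hcol : ∀ j, (y ⬝ᵥ fun i => F i j) = (F.submatrix id (Fin.cons j e)).det := by
    intro j
    rw [hy, cofactors_dotProduct]
    congr 1
    ext a b : 2
    refine Fin.cases ?_ (fun b => ?_) b <;> simp [consCol]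
  have hcol0 : ∀ i, (y ⬝ᵥ fun i' => F i' (e i)) = 0 := by
    intro i
    rw [hcol]
    refine Matrix.det_zero_of_column_eq (i := 0) (j := i.succ) (Fin.succ_ne_zero i).symm ?_
    intro a
    simp
  have hcolI : ∀ j, (y ⬝ᵥ fun i => F i j) ∈ sysIdeal F g := by
    intro j
    by_cases hj : ∃ i, e i = j
    · obtain ⟨i, rfl⟩ := hj
      rw [hcol0]
      exact zero_mem _
    · rw [hcol]
      have hinj : Function.Injective (Fin.cons j e : Fin (p + 1) → Fin q) :=
        Fin.cons_injective_iff.2 ⟨fun ⟨i, hi⟩ => hj ⟨i, hi⟩, e.injective⟩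
      exact sysGen_mem F g (Sum.inl ⟨_, hinj⟩)
  let T : Finset (MvPolynomial (Fin n) (Polynomial k)) :=
    Z.image (fun j => y ⬝ᵥ fun i => F i j) ∪ univ.image g
  have hTcard : T.card ≤ n := by
    refine (Finset.card_union_le _ _).trans ?_
    have h1 := Finset.card_image_le (s := Z) (f := fun j => y ⬝ᵥ fun i => F i j)
    have h2 := Finset.card_image_le (s := (univ : Finset (Fin s))) (f := g)
    rw [Finset.card_univ, Fintype.card_fin] at h2
    omega
  have hTI : Ideal.span (T : Set (MvPolynomial (Fin n) (Polynomial k))) ≤ sysIdeal F g := by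
    rw [Ideal.span_le]
    intro a ha
    rcases Finset.mem_union.1 ha with ha | ha
    · obtain ⟨j, _, rfl⟩ := Finset.mem_image.1 ha
      exact hcolI j
    · obtain ⟨i, _, rfl⟩ := Finset.mem_image.1 ha
      exact sysGen_mem F g (Sum.inr i)
  have hle : ∀ 𝔭 : Ideal (MvPolynomial (Fin n) (Polynomial k)), 𝔭.IsPrime →
      Ideal.span (T : Set (MvPolynomial (Fin n) (Polynomial k))) ≤ 𝔭 → 𝔭 ≤ 𝔪 →
      sysIdeal F g ≤ 𝔭 := by
    intro 𝔭 h𝔭 hT𝔭 h𝔭𝔪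
    rw [sysIdeal, Ideal.span_le]
    rintro _ ⟨c | i, rfl⟩
    · refine minor_mem_of_cofactors (y := y) (w := w) ?_ (fun j => ?_) c
      · rw [hy, cofactors_dotProduct]
        exact fun h => hw (h𝔭𝔪 h)
      · by_cases hj : j ∈ Z
        · exact hT𝔭 (Ideal.subset_span (Finset.mem_coe.2 (Finset.mem_union_left _
            (Finset.mem_image_of_mem _ hj))))
        · obtain ⟨i, rfl⟩ := he j hj
          rw [hcol0]
          exact zero_mem _
    · exact hT𝔭 (Ideal.subset_span (Finset.mem_coe.2 (Finset.mem_union_right _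
        (Finset.mem_image_of_mem _ (Finset.mem_univ i)))))
  by_contra! hno
  have hmin : 𝔪 ∈ (Ideal.span (T : Set (MvPolynomial (Fin n) (Polynomial k)))).minimalPrimes := by
    refine ⟨⟨Ideal.IsMaximal.isPrime ‹_›, hTI.trans hI⟩, fun 𝔭 h𝔭 h => ?_⟩
    by_contra hlt
    exact hno 𝔭 h𝔭.1 (hle 𝔭 h𝔭.1 h𝔭.2 h) (lt_of_le_not_ge h hlt)
  have h1 := Ideal.height_le_card_of_mem_minimalPrimes_span_finset hmin
  rw [height_of_isMaximal] at h1
  have h2 : n + 1 ≤ T.card := by exact_mod_cast h1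
  omega

/-- The parameter of a one-parameter family. -/
noncomputable abbrev param (k : Type*) [Field k] (n : ℕ) : MvPolynomial (Fin n) (Polynomial k) :=
  C Polynomial.X

/-- Specialization of a one-parameter family. -/
noncomputable abbrev spec (n : ℕ) (c : k) :
    MvPolynomial (Fin n) (Polynomial k) →+* MvPolynomial (Fin n) k :=
  map (Polynomial.evalRingHom c)

/-- The constant family. -/
noncomputable abbrev cst (k : Type*) [Field k] (n : ℕ) :
    MvPolynomial (Fin n) k →+* MvPolynomial (Fin n) (Polynomial k) :=
  map Polynomial.C

lemma spec_cst (c : k) (f : MvPolynomial (Fin n) k) : spec n c (cst k n f) = f := by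
  rw [spec, cst, MvPolynomial.map_map,
    show (Polynomial.evalRingHom c).comp Polynomial.C = RingHom.id k from RingHom.ext (by simp),
    MvPolynomial.map_id]

lemma sub_cst_spec_mem (c : k) (f : MvPolynomial (Fin n) (Polynomial k)) :
    f - cst k n (spec n c f) ∈ Ideal.span {param k n - C (Polynomial.C c)} := by
  induction f using MvPolynomial.induction_on with
  | C a =>
    obtain ⟨b, hb⟩ := Polynomial.X_sub_C_dvd_sub_C_eval (p := a) (a := c)
    rw [Ideal.mem_span_singleton']
    refine ⟨C b, ?_⟩
    simp only [spec, cst, map_C, Polynomial.coe_evalRingHom]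
    rw [← C_sub, ← C_sub, hb, C_mul, mul_comm]
  | add f g hf hg =>
    convert! add_mem hf hg using 1
    simp only [map_add]
    ring
  | mul_X f i hf =>
    convert! Ideal.mul_mem_left _ (X i) hf using 1
    simp only [map_mul, spec, cst, map_X]
    ring

lemma consCol_det_notMem [CharZero k] {d : Fin q ⊕ Fin s → ℕ}
    {c : (Fin q ⊕ Fin s) × ℕ → k}
    {𝔪 : Ideal (MvPolynomial (Fin n) (Polynomial k))} [𝔪.IsPrime] {e : Fin p ↪ Fin q}
    (he : ∀ i, starProd n d c (Sum.inl (e i)) ∉ 𝔪.comap (cst k n))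
    {F : Matrix (Fin (p + 1)) (Fin q) (MvPolynomial (Fin n) (Polynomial k))}
    (hF : ∀ i j, F i j - cst k n (starMat (p + 1) n d c i j) ∈ 𝔪) :
    (consCol (fun i => C (Polynomial.C ((q : k) ^ (i : ℕ)))) (F.submatrix id e)).det ∉ 𝔪 := by
  let Q := MvPolynomial (Fin n) (Polynomial k) ⧸ 𝔪
  let π : MvPolynomial (Fin n) (Polynomial k) →+* Q := Ideal.Quotient.mk 𝔪
  let θ : Fin (p + 1) → k := Fin.cons (q : k) fun i => (e i : k)
  let ψ : Fin (p + 1) → MvPolynomial (Fin n) k :=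
    Fin.cons 1 fun i => starProd n d c (Sum.inl (e i))
  have hmat : (consCol (fun i => C (Polynomial.C ((q : k) ^ (i : ℕ)))) (F.submatrix id e)).map π =
      Matrix.of fun i j => π (cst k n (ψ j)) *
        ((Matrix.vandermonde θ).transpose.map fun a => π (C (Polynomial.C a))) i j := by
    ext i j : 2
    refine Fin.cases ?_ (fun j => ?_) j
    · simp only [Matrix.map_apply, consCol, Matrix.of_apply, Fin.cons_zero, ψ, θ,
        Matrix.transpose_apply, Matrix.vandermonde_apply, map_one, one_mul]
    · have := Ideal.Quotient.eq.2 (hF i (e j))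
      simp only [Matrix.map_apply, consCol, Matrix.of_apply, Fin.cons_succ, Matrix.submatrix_apply,
        id_eq, ψ, θ, Matrix.transpose_apply, Matrix.vandermonde_apply]
      refine this.trans ?_
      rw [← map_mul, mul_comm]
      simp only [starMat, Matrix.of_apply, map_mul, cst, map_C]
      rfl
  have hdet := RingHom.map_det (S := Q) π
    (consCol (fun i => C (Polynomial.C ((q : k) ^ (i : ℕ)))) (F.submatrix id e))
  rw [RingHom.mapMatrix_apply, hmat, Matrix.det_mul_row] at hdet
  rw [← Ideal.Quotient.eq_zero_iff_mem]
  change ¬ π _ = 0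
  rw [hdet]
  have hmap : ((Matrix.vandermonde θ).transpose.map fun a => π (C (Polynomial.C a))) =
      (π.comp ((C (σ := Fin n)).comp (Polynomial.C (R := k)))).mapMatrix
        (Matrix.vandermonde θ).transpose := rfl
  rw [hmap, ← RingHom.map_det, Matrix.det_transpose, mul_eq_zero, not_or]
  constructor
  · rw [← map_prod, Ideal.Quotient.eq_zero_iff_mem, Ideal.IsPrime.prod_mem_iff]
    rintro ⟨j, _, hj⟩
    revert hj
    refine Fin.cases ?_ (fun j => ?_) j
    · intro h
      simp only [ψ, Fin.cons_zero, map_one] at h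
      exact (Ideal.ne_top_iff_one 𝔪).1 (Ideal.IsPrime.ne_top ‹_›) h
    · simpa [ψ] using he j
  · intro h
    rw [map_eq_zero_iff _ (RingHom.injective _)] at h
    revert h
    refine Matrix.det_vandermonde_ne_zero_iff.2 (Fin.cons_injective_iff.2 ⟨?_, ?_⟩)
    · rintro ⟨i, hi⟩
      exact (e i).isLt.ne (Nat.cast_injective hi)
    · exact fun a b h => e.injective (Fin.ext (Nat.cast_injective h))

/-- The parameter is not a zero divisor on a family deforming the start system. -/
lemma mem_of_param_mul_mem [CharZero k] (hn : n + (p + 1) = q + s + 1)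
    {d : Fin q ⊕ Fin s → ℕ}
    {F : Matrix (Fin (p + 1)) (Fin q) (MvPolynomial (Fin n) (Polynomial k))}
    {g : Fin s → MvPolynomial (Fin n) (Polynomial k)}
    (hF : ∀ i j, spec n 0 (F i j) = starMat (p + 1) n d (startConst n) i j)
    (hg : ∀ i, spec n 0 (g i) = starEqs n d (startConst n) i)
    {z : MvPolynomial (Fin n) (Polynomial k)} (hz : param k n * z ∈ sysIdeal F g) :
    z ∈ sysIdeal F g := by
  classical
  set I := sysIdeal F g
  set S : Ideal (MvPolynomial (Fin n) k) :=
    sysIdeal (starMat (p + 1) n d (startConst n)) (starEqs n d (startConst n)) with hS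
  set u := param k n
  let J : Ideal (MvPolynomial (Fin n) (Polynomial k)) := I.colon {z}
  by_contra hzI
  have hJ : J ≠ ⊤ := by
    rw [Ideal.ne_top_iff_one, Submodule.mem_colon_singleton]
    simpa using hzI
  obtain ⟨𝔪, h𝔪, hJ𝔪⟩ := Ideal.exists_le_maximal J hJ
  have hJmem : ∀ r, r * z ∈ I → r ∈ 𝔪 := fun r hr =>
    hJ𝔪 (Submodule.mem_colon_singleton.2 (by simpa using hr))
  have hu : u ∈ 𝔪 := hJmem u hz
  have hI : I ≤ 𝔪 := fun r hr => hJmem r (Ideal.mul_mem_right _ _ hr)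
  have hsub : ∀ f, f - cst k n (spec n 0 f) ∈ Ideal.span {u} := fun f => by
    simpa using sub_cst_spec_mem (0 : k) f
  have hSI : S.map (cst k n) ≤ I ⊔ Ideal.span {u} := by
    rw [hS, map_sysIdeal]
    refine sysIdeal_le_of_congr _ (fun i j => ?_) (fun i => ?_)
    · have := (Ideal.span {u}).neg_mem (hsub (F i j))
      rw [hF] at this
      simpa using this
    · have := (Ideal.span {u}).neg_mem (hsub (g i))
      rw [hg] at this
      simpa using this
  have hu' : Ideal.span {u} ≤ 𝔪 := (Ideal.span_singleton_le_iff_mem _).2 hu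
  have hSm : S ≤ 𝔪.comap (cst k n) := Ideal.map_le_iff_le_comap.1 (hSI.trans (sup_le hI hu'))
  obtain ⟨Z, hZ, hZφ, hloc⟩ := start_local hn hSm
  have hm : ∀ a ∈ 𝔪, ∃ r ∉ 𝔪, r * a ∈ I ⊔ Ideal.span {u} := by
    intro a ha
    have h1 : cst k n (spec n 0 a) ∈ 𝔪 := by
      simpa using 𝔪.sub_mem ha (hu' (hsub a))
    obtain ⟨r, hr, hra⟩ := hloc _ h1
    refine ⟨cst k n r, hr, ?_⟩
    have h2 := hSI (Ideal.mem_map_of_mem (cst k n) hra)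
    have h3 := Ideal.mem_sup_right (S := I) (Ideal.mul_mem_left _ (cst k n r) (hsub a))
    convert! add_mem h2 h3 using 1
    rw [map_mul]
    ring
  let e : Fin p ↪ Fin q := ((Zᶜ).orderEmbOfFin (by
    rw [Finset.card_compl, Fintype.card_fin]; omega)).toEmbedding
  have heZ : ∀ i, e i ∉ Z := fun i => by
    have : e i ∈ Zᶜ := Finset.orderEmbOfFin_mem _ _ i
    simpa using this
  have he : ∀ j ∉ Z, ∃ i, e i = j := by
    intro j hj
    have : j ∈ Set.range e := by
      change j ∈ Set.range ((Zᶜ).orderEmbOfFin _)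
      rw [Finset.range_orderEmbOfFin]
      simpa using hj
    exact this
  obtain ⟨𝔭, h𝔭, hI𝔭, h𝔭𝔪⟩ := exists_prime_lt hI Z (by omega) he
    (consCol_det_notMem (fun i => hZφ _ (heZ i)) fun i j => by
      rw [← hF]
      exact hu' (hsub _))
  have hu𝔭 : u ∉ 𝔭 := by
    intro h
    refine h𝔭𝔪.not_ge fun a ha => ?_
    obtain ⟨r, hr, hra⟩ := hm a ha
    have h1 := sup_le hI𝔭 ((Ideal.span_singleton_le_iff_mem _).2 h) hra
    exact (h𝔭.mem_or_mem h1).resolve_left fun h => hr (h𝔭𝔪.le h)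
  obtain ⟨r, hr, hrz⟩ := exists_notMem_mul_mem hI𝔭 h𝔭𝔪.le hu hu𝔭 hm hz
  exact hr (hJmem r hrz)

end Krull

section Freeness

variable {k : Type*} [Field k] {p q s n : ℕ}

/-- A determinantal system over a `k`-algebra whose leading forms are those of the star system. -/
structure HasStarTop (k : Type*) [Field k] {Λ : Type*} [CommRing Λ] [Algebra k Λ]
    (d : Fin q ⊕ Fin s → ℕ) (F : Matrix (Fin p) (Fin q) (MvPolynomial (Fin n) Λ))
    (g : Fin s → MvPolynomial (Fin n) Λ) : Prop where
  mat : ∀ i j, IsTop (d (Sum.inl j)) (F i j) (map (algebraMap k Λ) (starMat p n d 0 i j))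
  eqs : ∀ i, IsTop (d (Sum.inr i)) (g i) (map (algebraMap k Λ) (starEqs n d 0 i))

lemma HasStarTop.map {Λ Λ' : Type*} [CommRing Λ] [Algebra k Λ] [CommRing Λ'] [Algebra k Λ']
    (φ : Λ →ₐ[k] Λ') {d : Fin q ⊕ Fin s → ℕ}
    {F : Matrix (Fin p) (Fin q) (MvPolynomial (Fin n) Λ)} {g : Fin s → MvPolynomial (Fin n) Λ}
    (h : HasStarTop k d F g) :
    HasStarTop k d (F.map (MvPolynomial.map φ.toRingHom))
      fun i => MvPolynomial.map φ.toRingHom (g i) := by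
  have hφ : φ.toRingHom.comp (algebraMap k Λ) = algebraMap k Λ' := RingHom.ext φ.commutes
  refine ⟨fun i j => ?_, fun i => ?_⟩
  · have := (h.mat i j).map φ.toRingHom
    rwa [MvPolynomial.map_map, hφ] at this
  · have := (h.eqs i).map φ.toRingHom
    rwa [MvPolynomial.map_map, hφ] at this

lemma HasStarTop.spec {d : Fin q ⊕ Fin s → ℕ}
    {F : Matrix (Fin p) (Fin q) (MvPolynomial (Fin n) (Polynomial k))}
    {g : Fin s → MvPolynomial (Fin n) (Polynomial k)} (h : HasStarTop k d F g) (c : k) :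
    HasStarTop k d (F.map (DetBound.spec n c)) fun i => DetBound.spec n c (g i) := by
  have := h.map (Polynomial.aeval c : Polynomial k →ₐ[k] k)
  have he : (Polynomial.aeval c : Polynomial k →ₐ[k] k).toRingHom = Polynomial.evalRingHom c := by
    ext <;> simp
  rwa [he] at this

lemma hasStarTop_star (d : Fin q ⊕ Fin s → ℕ) (c : (Fin q ⊕ Fin s) × ℕ → k) :
    HasStarTop k d (starMat p n d c) (starEqs n d c) := by
  refine ⟨fun i j => ?_, fun i => ?_⟩
  · simpa [MvPolynomial.map_id] using starMat_isTop d c i j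
  · simpa [starEqs, MvPolynomial.map_id] using starProd_isTop d c (Sum.inr i)

/-- A homogeneous set of generators of `k[X]` modulo the star system. -/
structure IsStarBasis (p : ℕ) (d : Fin q ⊕ Fin s → ℕ)
    (B : Fin (detBound p d) → MvPolynomial (Fin n) k) : Prop where
  hom : ∃ β : Fin (detBound p d) → ℕ, ∀ i, (B i).IsHomogeneous (β i)
  span : SpansMod B (sysIdeal (starMat p n d 0) (starEqs n d 0))

lemma exists_isStarBasis [CharZero k] (hpq : p ≤ q) (hn : n + p = q + s + 1)
    (d : Fin q ⊕ Fin s → ℕ) :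
    ∃ B : Fin (detBound p d) → MvPolynomial (Fin n) k, IsStarBasis p d B := by
  obtain ⟨B, β, hB, hspan⟩ := hSpans_star (k := k) hpq hn d
  exact ⟨B, ⟨β, hB⟩, hspan⟩

variable {d : Fin q ⊕ Fin s → ℕ}

lemma IsStarBasis.spansMod {Λ : Type*} [CommRing Λ] [Algebra k Λ]
    {B : Fin (detBound p d) → MvPolynomial (Fin n) k} (hB : IsStarBasis p d B)
    {F : Matrix (Fin p) (Fin q) (MvPolynomial (Fin n) Λ)} {g : Fin s → MvPolynomial (Fin n) Λ}
    (h : HasStarTop k d F g) :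
    SpansMod (fun i => MvPolynomial.map (algebraMap k Λ) (B i)) (sysIdeal F g) := by
  obtain ⟨β, hβ⟩ := hB.hom
  have hstar := hasStarTop_star (k := k) (p := p) (n := n) d 0
  refine SpansMod.of_isTop (δ := genDeg p d) (fun a => ?_) hβ hB.span (fun a => ?_)
  · exact (sysGen_isTop (fun i j => starMat_isTop d 0 i j)
      (fun i => starProd_isTop d 0 (Sum.inr i)) a).1
  · have := sysGen_isTop h.mat h.eqs a
    convert! this using 1
    exact (sysGen_map (MvPolynomial.map (algebraMap k Λ)) _ _ a).symm

lemma IsStarBasis.spansMod_field {B : Fin (detBound p d) → MvPolynomial (Fin n) k}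
    (hB : IsStarBasis p d B) {F : Matrix (Fin p) (Fin q) (MvPolynomial (Fin n) k)}
    {g : Fin s → MvPolynomial (Fin n) k} (h : HasStarTop k d F g) :
    SpansMod B (sysIdeal F g) := by
  simpa [MvPolynomial.map_id] using hB.spansMod h

lemma spec_sum (c : k) {ι : Type*} [Fintype ι] (a : ι → Polynomial k)
    (B : ι → MvPolynomial (Fin n) k) :
    spec n c (∑ i, C (a i) * cst k n (B i)) = ∑ i, C ((a i).eval c) * B i := by
  rw [map_sum]
  refine Finset.sum_congr rfl fun i _ => ?_
  rw [map_mul, spec_cst]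
  simp [spec]

lemma spec_mem_sysIdeal (c : k) {F : Matrix (Fin p) (Fin q) (MvPolynomial (Fin n) (Polynomial k))}
    {g : Fin s → MvPolynomial (Fin n) (Polynomial k)} {f} (hf : f ∈ sysIdeal F g) :
    spec n c f ∈ sysIdeal (F.map (spec n c)) fun i => spec n c (g i) := by
  rw [← map_sysIdeal]
  exact Ideal.mem_map_of_mem _ hf

/-- Independence of a star basis modulo a family deforming the start system. -/
lemma IsStarBasis.independent_of_start [CharZero k] {d : Fin q ⊕ Fin s → ℕ}
    {B : Fin (detBound (p + 1) d) → MvPolynomial (Fin n) k} (hB : IsStarBasis (p + 1) d B)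
    (hpq : p + 1 ≤ q) (hn : n + (p + 1) = q + s + 1)
    {F : Matrix (Fin (p + 1)) (Fin q) (MvPolynomial (Fin n) (Polynomial k))}
    {g : Fin s → MvPolynomial (Fin n) (Polynomial k)}
    (hF : ∀ i j, DetBound.spec n 0 (F i j) = starMat (p + 1) n d (startConst n) i j)
    (hg : ∀ i, DetBound.spec n 0 (g i) = starEqs n d (startConst n) i)
    {a : Fin (detBound (p + 1) d) → Polynomial k}
    (ha : ∑ i, C (a i) * cst k n (B i) ∈ sysIdeal F g) : a = 0 := by
  have key : ∀ (N : ℕ) (a : Fin (detBound (p + 1) d) → Polynomial k),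
      ∑ i, C (a i) * cst k n (B i) ∈ sysIdeal F g → ∀ i, Polynomial.X ^ N ∣ a i := by
    intro N
    induction N with
    | zero => simp
    | succ N ih =>
      intro a ha i
      have h1 := spec_mem_sysIdeal 0 ha
      rw [spec_sum, show F.map (DetBound.spec n 0) = starMat (p + 1) n d (startConst n) from
        Matrix.ext hF, funext hg] at h1
      have h2 := start_independent hpq hn (hB.spansMod_field (hasStarTop_star d _)) h1
      have h3 : ∀ i, Polynomial.X ∣ a i := fun i => by
        rw [Polynomial.X_dvd_iff, Polynomial.coeff_zero_eq_eval_zero]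
        exact congrFun h2 i
      choose b hb using h3
      have h4 : param k n * ∑ i, C (b i) * cst k n (B i) ∈ sysIdeal F g := by
        convert! ha using 1
        rw [Finset.mul_sum]
        refine Finset.sum_congr rfl fun i _ => ?_
        rw [hb i, C_mul, mul_assoc]
      rw [hb i, pow_succ']
      exact mul_dvd_mul_left _ (ih b (mem_of_param_mul_mem hn hF hg h4) i)
  funext i
  ext m
  simpa using Polynomial.X_pow_dvd_iff.1 (key (m + 1) a ha i) m (Nat.lt_succ_self m)

/-- The family joining two polynomials. -/
noncomputable def joinPoly (f h : MvPolynomial (Fin n) k) : MvPolynomial (Fin n) (Polynomial k) :=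
  cst k n f + param k n * cst k n (h - f)

lemma spec_joinPoly (c : k) (f h : MvPolynomial (Fin n) k) :
    spec n c (joinPoly f h) = f + C c * (h - f) := by
  rw [joinPoly, map_add, map_mul, spec_cst, spec_cst]
  simp [spec, param]

lemma spec_zero_joinPoly (f h : MvPolynomial (Fin n) k) : spec n 0 (joinPoly f h) = f := by
  simp [spec_joinPoly]

lemma spec_one_joinPoly (f h : MvPolynomial (Fin n) k) : spec n 1 (joinPoly f h) = h := by
  simp [spec_joinPoly]

lemma joinPoly_isTop {e : ℕ} {f h m : MvPolynomial (Fin n) k} (hf : IsTop e f m)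
    (hh : IsTop e h m) : IsTop e (joinPoly f h) (cst k n m) := by
  refine (hf.map Polynomial.C).add_low ?_
  rw [← smul_eq_C_mul]
  refine Submodule.smul_mem _ _ (map_mem_degLT _ ?_)
  convert! sub_mem hh.2 hf.2 using 1
  ring

lemma joinPoly_hasStarTop {F F' : Matrix (Fin p) (Fin q) (MvPolynomial (Fin n) k)}
    {g g' : Fin s → MvPolynomial (Fin n) k} (h : HasStarTop k d F g) (h' : HasStarTop k d F' g') :
    HasStarTop k d (Matrix.of fun i j => joinPoly (F i j) (F' i j))
      fun i => joinPoly (g i) (g' i) := by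
  refine ⟨fun i j => joinPoly_isTop ?_ ?_, fun i => joinPoly_isTop ?_ ?_⟩
  · simpa [MvPolynomial.map_id] using h.mat i j
  · simpa [MvPolynomial.map_id] using h'.mat i j
  · simpa [MvPolynomial.map_id] using h.eqs i
  · simpa [MvPolynomial.map_id] using h'.eqs i

lemma spec_surjective (c : k) : Function.Surjective (spec n c) := fun f =>
  ⟨cst k n f, spec_cst c f⟩

/-- A star basis is independent modulo every system with the same leading forms. -/
lemma IsStarBasis.independent_field [CharZero k] {d : Fin q ⊕ Fin s → ℕ}
    {B : Fin (detBound (p + 1) d) → MvPolynomial (Fin n) k} (hB : IsStarBasis (p + 1) d B)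
    (hpq : p + 1 ≤ q) (hn : n + (p + 1) = q + s + 1)
    {F : Matrix (Fin (p + 1)) (Fin q) (MvPolynomial (Fin n) k)}
    {g : Fin s → MvPolynomial (Fin n) k} (h : HasStarTop k d F g)
    {r : Fin (detBound (p + 1) d) → k} (hr : ∑ i, C (r i) * B i ∈ sysIdeal F g) : r = 0 := by
  have htop := joinPoly_hasStarTop (hasStarTop_star (k := k) (p := p + 1) (n := n) d
    (startConst n)) h
  set 𝓕 : Matrix (Fin (p + 1)) (Fin q) (MvPolynomial (Fin n) (Polynomial k)) :=
    Matrix.of fun i j => joinPoly (starMat (p + 1) n d (startConst n) i j) (F i j) with h𝓕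
  set 𝓰 : Fin s → MvPolynomial (Fin n) (Polynomial k) :=
    fun i => joinPoly (starEqs n d (startConst n) i) (g i) with h𝓰
  have h1 : (sysIdeal 𝓕 𝓰).map (DetBound.spec n 1) = sysIdeal F g := by
    rw [map_sysIdeal]
    congr 1
    · exact Matrix.ext fun i j => spec_one_joinPoly _ _
    · funext i
      exact spec_one_joinPoly _ _
  rw [← h1, Ideal.mem_map_iff_of_surjective _ (spec_surjective (1 : k))] at hr
  obtain ⟨y, hy, hyr⟩ := hr
  have h2 := sub_cst_spec_mem (1 : k) y
  obtain ⟨b, hb⟩ := Ideal.mem_span_singleton'.1 h2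
  obtain ⟨a, ha⟩ := hB.spansMod htop b
  have h3 : ∑ i, C (Polynomial.C (r i) + (Polynomial.X - Polynomial.C 1) * a i) * cst k n (B i) ∈
      sysIdeal 𝓕 𝓰 := by
    convert! sub_mem hy (Ideal.mul_mem_left _ (param k n - C (Polynomial.C 1)) ha) using 1
    rw [hyr] at hb
    rw [mul_sub, mul_comm _ b, hb, Finset.mul_sum, map_sum]
    simp only [map_mul, map_add, map_sub, add_mul, Finset.sum_add_distrib, map_C,
      Polynomial.algebraMap_eq]
    simp only [mul_assoc]
    ring
  have h4 := hB.independent_of_start hpq hn (fun i j => spec_zero_joinPoly _ _)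
    (fun i => spec_zero_joinPoly _ _) h3
  funext i
  have := congrArg (Polynomial.eval 1) (congrFun h4 i)
  simpa using this

/-- A star basis is independent modulo every family with the same leading forms. -/
lemma IsStarBasis.independent [CharZero k] {d : Fin q ⊕ Fin s → ℕ}
    {B : Fin (detBound (p + 1) d) → MvPolynomial (Fin n) k} (hB : IsStarBasis (p + 1) d B)
    (hpq : p + 1 ≤ q) (hn : n + (p + 1) = q + s + 1)
    {F : Matrix (Fin (p + 1)) (Fin q) (MvPolynomial (Fin n) (Polynomial k))}
    {g : Fin s → MvPolynomial (Fin n) (Polynomial k)} (h : HasStarTop k d F g)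
    {a : Fin (detBound (p + 1) d) → Polynomial k}
    (ha : ∑ i, C (a i) * cst k n (B i) ∈ sysIdeal F g) : a = 0 := by
  funext i
  refine Polynomial.funext fun c => ?_
  have h1 := spec_mem_sysIdeal c ha
  rw [spec_sum] at h1
  simpa using congrFun (hB.independent_field hpq hn (h.spec c) h1) i

/-- The parameter is not a zero divisor on a family with constant star leading forms. -/
lemma HasStarTop.mem_of_param_pow_mul_mem [CharZero k] {d : Fin q ⊕ Fin s → ℕ}
    (hpq : p + 1 ≤ q) (hn : n + (p + 1) = q + s + 1)
    {F : Matrix (Fin (p + 1)) (Fin q) (MvPolynomial (Fin n) (Polynomial k))}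
    {g : Fin s → MvPolynomial (Fin n) (Polynomial k)} (h : HasStarTop k d F g) (N : ℕ)
    {z : MvPolynomial (Fin n) (Polynomial k)} (hz : param k n ^ N * z ∈ sysIdeal F g) :
    z ∈ sysIdeal F g := by
  obtain ⟨B, hB⟩ := exists_isStarBasis (k := k) hpq hn d
  obtain ⟨a, ha⟩ := hB.spansMod h z
  have h1 : ∑ i, C (Polynomial.X ^ N * a i) * cst k n (B i) ∈ sysIdeal F g := by
    convert! sub_mem hz (Ideal.mul_mem_left _ (param k n ^ N) ha) using 1
    rw [mul_sub, sub_sub_cancel, Finset.mul_sum]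
    refine Finset.sum_congr rfl fun i _ => ?_
    rw [C_mul, C_pow, mul_assoc]
    rfl
  have h2 := hB.independent hpq hn h h1
  have h3 : a = 0 := funext fun i => by simpa using congrFun h2 i
  simpa [h3] using ha

end Freeness

section GenericDimension

variable {k : Type*} [Field k] {p q s n : ℕ}

lemma exists_mem_degLT_eq (c : k) {e : ℕ} {f : MvPolynomial (Fin n) (Polynomial k)}
    (hf : f ∈ degLT (Fin n) (Polynomial k) e) :
    ∃ h ∈ degLT (Fin n) (Polynomial k) e,
      f = cst k n (spec n c f) + C (Polynomial.X - Polynomial.C c) * h := by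
  obtain ⟨h, hh⟩ := Ideal.mem_span_singleton'.1 (sub_cst_spec_mem c f)
  rw [← C_sub] at hh
  refine ⟨h, fun m hm => ?_, by linear_combination -hh⟩
  have h1 := map_mem_degLT Polynomial.C (map_mem_degLT (Polynomial.evalRingHom c) hf)
  have h2 := sub_mem hf h1 m hm
  rw [← hh, mul_comm, coeff_C_mul] at h2
  exact (mul_eq_zero.1 h2).resolve_left (Polynomial.X_sub_C_ne_zero c)

lemma degLT_eq_span (R : Type*) [CommRing R] (e : ℕ) :
    degLT (Fin n) R e =
      Submodule.span R ((fun m => monomial m (1 : R)) '' {m : Fin n →₀ ℕ | m.degree < e}) := by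
  apply le_antisymm
  · intro f hf
    rw [f.as_sum]
    refine Submodule.sum_mem _ fun m hm => ?_
    have h1 : monomial m (coeff m f) = coeff m f • monomial m (1 : R) := by
      rw [smul_monomial, smul_eq_mul, mul_one]
    rw [h1]
    refine Submodule.smul_mem _ _ (Submodule.subset_span ⟨m, ?_, rfl⟩)
    by_contra hc
    exact mem_support_iff.1 hm (hf m (not_lt.1 hc))
  · rw [Submodule.span_le]
    rintro _ ⟨m, hm, rfl⟩ m' hm'
    classical
    change m.degree < e at hm
    rw [coeff_monomial, if_neg]
    rintro rfl
    omega

lemma degLT_fg (R : Type*) [CommRing R] (e : ℕ) : (degLT (Fin n) R e).FG := by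
  rw [degLT_eq_span]
  refine Submodule.fg_span (Set.Finite.image _ ?_)
  exact (Finsupp.finite_of_degree_le e).subset fun m (hm : m.degree < e) => hm.le

variable {d : Fin q ⊕ Fin s → ℕ}

/-- Up to a denominator that is invertible at `t = 1`, polynomials of bounded degree are
combinations of a star basis modulo a family specializing to the star system at `t = 1`. -/
lemma IsStarBasis.exists_denominator {B : Fin (detBound p d) → MvPolynomial (Fin n) k}
    (hB : IsStarBasis p d B)
    {F : Matrix (Fin p) (Fin q) (MvPolynomial (Fin n) (Polynomial k))}
    {g : Fin s → MvPolynomial (Fin n) (Polynomial k)}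
    (hF : ∀ i j, F i j ∈ degLT (Fin n) (Polynomial k) (d (Sum.inl j) + 1))
    (hg : ∀ i, g i ∈ degLT (Fin n) (Polynomial k) (d (Sum.inr i) + 1))
    (hF1 : ∀ i j, DetBound.spec n 1 (F i j) = starMat p n d 0 i j)
    (hg1 : ∀ i, DetBound.spec n 1 (g i) = starEqs n d 0 i) (δ : ℕ) :
    ∃ b : Polynomial k, b ≠ 0 ∧ ∀ f ∈ degLT (Fin n) (Polynomial k) (δ + 1),
      ∃ r : Fin (detBound p d) → Polynomial k,
        C b * f - ∑ i, C (r i) * cst k n (B i) ∈ sysIdeal F g := by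
  classical
  obtain ⟨β, hβ⟩ := hB.hom
  let P := degLT (Fin n) (Polynomial k) (δ + 1)
  let W := Submodule.span (Polynomial k) (Set.range fun i => cst k n (B i))
  let N := W ⊔ (sysIdeal F g).restrictScalars (Polynomial k)
  let τ : Ideal (Polynomial k) := Ideal.span {Polynomial.X - Polynomial.C 1}
  have hspec : ∀ a, DetBound.spec n 1 (sysGen F g a) =
      sysGen (starMat p n d 0) (starEqs n d 0) a := by
    intro a
    rw [← sysGen_map, show F.map (DetBound.spec n 1) = starMat p n d 0 from Matrix.ext hF1,
      funext hg1]
  have hmono : ∀ m : Fin n →₀ ℕ, m.degree < δ + 1 →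
      monomial m (1 : Polynomial k) ∈ N ⊔ τ • P := by
    intro m hm
    have hhom : (monomial m (1 : k)).IsHomogeneous m.degree := isHomogeneous_monomial 1 rfl
    obtain ⟨r, c, hc, hmc⟩ := exists_homogeneous_combination
      (m := sysGen (starMat p n d 0) (starEqs n d 0)) (δ := genDeg p d) (fun a =>
      (sysGen_isTop (fun i j => starMat_isTop (k := k) (p := p) (n := n) d 0 i j)
        (fun i => starProd_isTop d 0 (Sum.inr i)) a).1) hβ hB.span hhom
    have h1 := congrArg (cst k n) hmc
    have h2 : cst k n (monomial m (1 : k)) = monomial m (1 : Polynomial k) := by simp [cst]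
    rw [h2, map_add, map_sum, map_sum] at h1
    rw [h1]
    refine add_mem (Submodule.sum_mem _ fun i _ => ?_) (Submodule.sum_mem _ fun a _ => ?_)
    · refine Submodule.mem_sup_left (Submodule.mem_sup_left ?_)
      rw [map_mul, cst, map_C, ← smul_eq_C_mul]
      exact Submodule.smul_mem _ _ (Submodule.subset_span ⟨i, rfl⟩)
    · rcases hc a with h0 | ⟨hle, hca⟩
      · simp [h0]
      · obtain ⟨h, hh, heq⟩ := exists_mem_degLT_eq (1 : k) (sysGen_mem_degLT hF hg a)
        rw [hspec] at heq
        have h3 : cst k n (c a * sysGen (starMat p n d 0) (starEqs n d 0) a) =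
            cst k n (c a) * sysGen F g a -
              (Polynomial.X - Polynomial.C 1 : Polynomial k) • (cst k n (c a) * h) := by
          rw [map_mul, heq, smul_eq_C_mul]
          ring
        rw [h3]
        refine sub_mem (Submodule.mem_sup_left (Submodule.mem_sup_right ?_))
          (Submodule.mem_sup_right (Submodule.smul_mem_smul (Ideal.mem_span_singleton_self _) ?_))
        · exact Ideal.mul_mem_left _ _ (sysGen_mem F g a)
        · refine degLT_mono ?_ (mul_mem_degLT_succ
            (map_mem_degLT Polynomial.C (mem_degLT_of_isHomogeneous hca)) hh)
          omega
  have hP : P ≤ N ⊔ τ • P := by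
    conv_lhs => rw [show P = _ from degLT_eq_span (Polynomial k) (δ + 1)]
    rw [Submodule.span_le]
    rintro _ ⟨m, hm, rfl⟩
    exact hmono m hm
  have hP' : P.map N.mkQ ≤ τ • P.map N.mkQ := by
    rw [← Submodule.map_smul'']
    refine (Submodule.map_mono hP).trans ?_
    rw [Submodule.map_sup, Submodule.mkQ_map_self, bot_sup_eq]
  obtain ⟨b, hb, hbP⟩ := Submodule.exists_sub_one_mem_and_smul_eq_zero_of_fg_of_le_smul τ
    (P.map N.mkQ) ((degLT_fg _ _).map _) hP'
  refine ⟨b, ?_, fun f hf => ?_⟩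
  · rintro rfl
    obtain ⟨c, hc⟩ := Ideal.mem_span_singleton'.1 hb
    have := congrArg (Polynomial.eval 1) hc
    simp at this
  · have h1 := hbP _ (Submodule.mem_map_of_mem hf)
    rw [← map_smul, Submodule.mkQ_apply, Submodule.Quotient.mk_eq_zero, smul_eq_C_mul] at h1
    obtain ⟨w, hw, y, hy, hwy⟩ := Submodule.mem_sup.1 h1
    obtain ⟨r, hr⟩ := (Submodule.mem_span_range_iff_exists_fun _).1 hw
    refine ⟨r, ?_⟩
    rw [← hwy]
    simp only [← smul_eq_C_mul, hr, add_sub_cancel_left]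
    exact hy

lemma exists_eq_X_pow_mul {ι : Type*} {r : ι → Polynomial k} (hr : r ≠ 0) :
    ∃ (a : ℕ) (r' : ι → Polynomial k), (∀ i, r i = Polynomial.X ^ a * r' i) ∧
      ∃ i, (r' i).eval 0 ≠ 0 := by
  classical
  have hex : ∃ N, ¬ ∀ i, Polynomial.X ^ N ∣ r i := by
    by_contra! hc
    refine hr (funext fun i => Polynomial.ext fun m => ?_)
    simpa using Polynomial.X_pow_dvd_iff.1 (hc (m + 1) i) m (Nat.lt_succ_self m)
  obtain ⟨a, ha⟩ : ∃ a, Nat.find hex = a + 1 :=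
    Nat.exists_eq_succ_of_ne_zero fun h => by
      have := Nat.find_spec hex
      rw [h] at this
      simp at this
  have h1 : ¬ ∀ i, Polynomial.X ^ (a + 1) ∣ r i := ha ▸ Nat.find_spec hex
  have h2 : ∀ i, Polynomial.X ^ a ∣ r i := not_not.1 (Nat.find_min hex (by omega))
  choose r' hr' using h2
  refine ⟨a, r', hr', ?_⟩
  by_contra! hc
  refine h1 fun i => ?_
  rw [hr' i, pow_succ]
  exact mul_dvd_mul_left _ (by
    rw [Polynomial.X_dvd_iff, Polynomial.coeff_zero_eq_eval_zero, hc i])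

/-- More than `detBound p d` polynomials are dependent modulo a family specializing to the star
system, after removing powers of the parameter. -/
lemma exists_relation [CharZero k] (hpq : p ≤ q) (hn : n + p = q + s + 1)
    {F : Matrix (Fin p) (Fin q) (MvPolynomial (Fin n) (Polynomial k))}
    {g : Fin s → MvPolynomial (Fin n) (Polynomial k)}
    (hF : ∀ i j, F i j ∈ degLT (Fin n) (Polynomial k) (d (Sum.inl j) + 1))
    (hg : ∀ i, g i ∈ degLT (Fin n) (Polynomial k) (d (Sum.inr i) + 1))
    (hF1 : ∀ i j, spec n 1 (F i j) = starMat p n d 0 i j)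
    (hg1 : ∀ i, spec n 1 (g i) = starEqs n d 0 i) {ι : Type*} [Fintype ι]
    (hι : detBound p d < Fintype.card ι) (f : ι → MvPolynomial (Fin n) k) :
    ∃ (a : ℕ) (r : ι → Polynomial k), (∃ i, (r i).eval 0 ≠ 0) ∧
      param k n ^ a * ∑ i, C (r i) * cst k n (f i) ∈ sysIdeal F g := by
  obtain ⟨B, hB⟩ := exists_isStarBasis (k := k) hpq hn d
  obtain ⟨b, hb, hbf⟩ := hB.exists_denominator hF hg hF1 hg1 (univ.sup fun i => (f i).totalDegree)
  have hmem : ∀ i, cst k n (f i) ∈ degLT (Fin n) (Polynomial k)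
      ((univ.sup fun i => (f i).totalDegree) + 1) := fun i =>
    map_mem_degLT _ (mem_degLT_of_totalDegree_le
      (Finset.le_sup (f := fun i => (f i).totalDegree) (Finset.mem_univ i)))
  choose v hv using fun i => hbf _ (hmem i)
  have hdep : ¬ LinearIndependent (Polynomial k) v := fun h => by
    have := h.fintype_card_le_finrank
    rw [Module.finrank_fin_fun] at this
    omega
  obtain ⟨w, hw, i₀, hi₀⟩ := Fintype.not_linearIndependent_iff.1 hdep
  have hwb : (fun i => w i * b) ≠ 0 := fun h => mul_ne_zero hi₀ hb (congrFun h i₀)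
  obtain ⟨a, r, hr, hr0⟩ := exists_eq_X_pow_mul hwb
  refine ⟨a, r, hr0, ?_⟩
  have h1 : param k n ^ a * ∑ i, C (r i) * cst k n (f i) =
      ∑ i, C (w i) * (C b * cst k n (f i) - ∑ l, C (v i l) * cst k n (B l)) := by
    simp only [mul_sub, Finset.sum_sub_distrib]
    have h2 : ∑ i, C (w i) * ∑ l, C (v i l) * cst k n (B l) = 0 := by
      simp only [Finset.mul_sum]
      rw [Finset.sum_comm]
      refine Finset.sum_eq_zero fun l _ => ?_
      simp only [← mul_assoc, ← C_mul]
      rw [← Finset.sum_mul, ← map_sum]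
      have := congrFun hw l
      simp only [Finset.sum_apply, Pi.smul_apply, smul_eq_mul, Pi.zero_apply] at this
      rw [this, C_0, zero_mul]
    rw [h2, sub_zero, Finset.mul_sum]
    refine Finset.sum_congr rfl fun i _ => ?_
    rw [← mul_assoc, ← mul_assoc, ← C_mul, hr i, C_mul, C_pow]
  rw [h1]
  exact Ideal.sum_mem _ fun i _ => Ideal.mul_mem_left _ _ (hv i)

end GenericDimension

section LocalDeformation

lemma exists_sub_one_mem_mul_mem {A : Type*} [CommRing A] [IsNoetherianRing A]
    {I I' 𝔪 : Ideal A} {N e : ℕ} (hN : N + 1 ≤ e) (hI : I ≤ I' ⊔ 𝔪 ^ e) {h c : A}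
    (hc : 1 - c * h ∈ 𝔪) (hh : ∀ f ∈ 𝔪 ^ N, h * f ∈ I) :
    ∃ h', h' - 1 ∈ 𝔪 ∧ ∀ f ∈ 𝔪 ^ N, h' * f ∈ I' := by
  have h1 : 𝔪 ^ N ≤ I' ⊔ 𝔪 • 𝔪 ^ N := by
    intro f hf
    have h2 : h * f ∈ I' ⊔ 𝔪 • 𝔪 ^ N := by
      refine sup_le_sup_left ?_ I' (hI (hh f hf))
      rw [smul_eq_mul, ← pow_succ']
      exact Ideal.pow_le_pow_right hN
    have h3 : (1 - c * h) * f ∈ I' ⊔ 𝔪 • 𝔪 ^ N :=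
      Ideal.mem_sup_right (Ideal.mul_mem_mul hc hf)
    convert! add_mem h3 (Ideal.mul_mem_left _ c h2) using 1
    ring
  have h4 : Submodule.map I'.mkQ (𝔪 ^ N) ≤ 𝔪 • Submodule.map I'.mkQ (𝔪 ^ N) := by
    rw [← Submodule.map_smul'']
    refine (Submodule.map_mono h1).trans ?_
    rw [Submodule.map_sup, Submodule.mkQ_map_self, bot_sup_eq]
  obtain ⟨r, hr, hr'⟩ := Submodule.exists_sub_one_mem_and_smul_eq_zero_of_fg_of_le_smul 𝔪
    (Submodule.map I'.mkQ (𝔪 ^ N)) ((IsNoetherian.noetherian _).map _) h4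
  refine ⟨r, hr, fun f hf => ?_⟩
  have := hr' _ (Submodule.mem_map_of_mem hf)
  rwa [← map_smul, Submodule.mkQ_apply, Submodule.Quotient.mk_eq_zero, smul_eq_mul] at this

variable {k : Type*} [Field k] {p q s n : ℕ}

/-- The maximal ideal of a point. -/
noncomputable abbrev ptIdeal (x : Fin n → k) : Ideal (MvPolynomial (Fin n) k) :=
  RingHom.ker (eval x)

/-- Constants making all linear factors of a star system vanish at a point. -/
noncomputable def pointConst (x : Fin n → k) (a : (Fin q ⊕ Fin s) × ℕ) : k :=
  eval x (powForm n (node k a))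

lemma starProd_pointConst_mem (x : Fin n → k) (d : Fin q ⊕ Fin s → ℕ) (j) :
    starProd n d (pointConst x) j ∈ ptIdeal x ^ d j := by
  have h := Ideal.prod_mem_prod (s := range (d j)) (I := fun _ => ptIdeal x)
    (x := fun l => powForm n (node k (j, l)) - C (pointConst x (j, l))) fun l _ => by
      simp [RingHom.mem_ker, pointConst]
  simpa [starProd] using h

lemma starMat_pointConst_mem (x : Fin n → k) (d : Fin q ⊕ Fin s → ℕ) (i : Fin p) (j) :
    starMat p n d (pointConst x) i j ∈ ptIdeal x ^ d (Sum.inl j) :=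
  Ideal.mul_mem_left _ _ (starProd_pointConst_mem x d _)

lemma exists_bound {ι : Type*} [Finite ι] (f : ι → ℕ) : ∃ b, ∀ i, f i ≤ b := by
  obtain ⟨b, hb⟩ := (Set.finite_range f).bddAbove
  exact ⟨b, fun i => hb ⟨i, rfl⟩⟩

/-- Near an isolated zero of the fibre at `t = 0`, multiples of powers of the parameter in the
ideal of a family specialize to the ideal of the fibre. -/
lemma spec_mem_of_param_pow_mul_mem [CharZero k] (hpq : p + 1 ≤ q)
    (hn : n + (p + 1) = q + s + 1)
    {F : Matrix (Fin (p + 1)) (Fin q) (MvPolynomial (Fin n) (Polynomial k))}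
    {g : Fin s → MvPolynomial (Fin n) (Polynomial k)}
    {F₀ : Matrix (Fin (p + 1)) (Fin q) (MvPolynomial (Fin n) k)}
    {g₀ : Fin s → MvPolynomial (Fin n) k} (hF₀ : ∀ i j, spec n 0 (F i j) = F₀ i j)
    (hg₀ : ∀ i, spec n 0 (g i) = g₀ i) {x : Fin n → k} {N : ℕ} {h : MvPolynomial (Fin n) k}
    (hx : eval x h ≠ 0) (hh : ∀ f ∈ ptIdeal x ^ N, h * f ∈ sysIdeal F₀ g₀) {a : ℕ}
    {f : MvPolynomial (Fin n) (Polynomial k)} (hf : param k n ^ a * f ∈ sysIdeal F g) :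
    spec n 0 f ∈ sysIdeal F₀ g₀ ⊔ ptIdeal x ^ N := by
  classical
  obtain ⟨b₁, hb₁⟩ := exists_bound fun ij : Fin (p + 1) × Fin q => (F ij.1 ij.2).totalDegree
  obtain ⟨b₂, hb₂⟩ := exists_bound fun i => (g i).totalDegree
  set e := b₁ + b₂ + N * (1 + (a + 1)) + N + 1 with he
  have heN : N + 1 ≤ e := by omega
  have heN' : N * (1 + (a + 1)) ≤ e := by omega
  set 𝔪 := ptIdeal x
  let H := starMat (k := k) (s := s) (p + 1) n (fun _ : Fin q ⊕ Fin s => e) (pointConst x)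
  let η := starEqs (k := k) (q := q) n (fun _ : Fin q ⊕ Fin s => e) (pointConst x)
  have hH : ∀ i j, H i j ∈ 𝔪 ^ e := fun i j =>
    starMat_pointConst_mem x (fun _ : Fin q ⊕ Fin s => e) i j
  have hη : ∀ i, η i ∈ 𝔪 ^ e := fun i =>
    starProd_pointConst_mem x (fun _ : Fin q ⊕ Fin s => e) (Sum.inr i)
  let F' : Matrix (Fin (p + 1)) (Fin q) (MvPolynomial (Fin n) (Polynomial k)) :=
    Matrix.of fun i j => cst k n (H i j) + F i j
  let g' : Fin s → MvPolynomial (Fin n) (Polynomial k) := fun i => cst k n (η i) + g i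
  have htop : HasStarTop k (fun _ : Fin q ⊕ Fin s => e) F' g' := by
    refine ⟨fun i j => ?_, fun i => ?_⟩
    · refine ((starMat_isTop (fun _ => e) (pointConst x) i j).map Polynomial.C).add_low
        (degLT_mono ?_ (exists_mem_degLT _))
      have : (F i j).totalDegree ≤ b₁ := hb₁ (i, j)
      change _ ≤ e
      omega
    · refine ((starProd_isTop (fun _ => e) (pointConst x) (Sum.inr i)).map Polynomial.C).add_low
        (degLT_mono ?_ (exists_mem_degLT _))
      have : (g i).totalDegree ≤ b₂ := hb₂ i
      change _ ≤ e
      omega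
  let F₁ : Matrix (Fin (p + 1)) (Fin q) (MvPolynomial (Fin n) k) :=
    Matrix.of fun i j => H i j + F₀ i j
  let g₁ : Fin s → MvPolynomial (Fin n) k := fun i => η i + g₀ i
  have hmap : (sysIdeal F' g').map (spec n 0) = sysIdeal F₁ g₁ := by
    rw [map_sysIdeal]
    congr 1
    · refine Matrix.ext fun i j => ?_
      change spec n 0 (cst k n (H i j) + F i j) = H i j + F₀ i j
      rw [map_add, spec_cst, hF₀]
    · funext i
      change spec n 0 (cst k n (η i) + g i) = η i + g₀ i
      rw [map_add, spec_cst, hg₀]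
  have h01 : sysIdeal F₀ g₀ ≤ sysIdeal F₁ g₁ ⊔ 𝔪 ^ e :=
    sysIdeal_le_of_congr _ (fun i j => by simpa [F₁] using hH i j)
      (fun i => by simpa [g₁] using hη i)
  have h10 : sysIdeal F₁ g₁ ≤ sysIdeal F₀ g₀ ⊔ 𝔪 ^ e :=
    sysIdeal_le_of_congr _ (fun i j => by simpa [F₁] using hH i j)
      (fun i => by simpa [g₁] using hη i)
  have hfam : sysIdeal F g ≤ sysIdeal F' g' ⊔ (𝔪.map (cst k n)) ^ e := by
    rw [← Ideal.map_pow]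
    refine sysIdeal_le_of_congr _ (fun i j => ?_) (fun i => ?_)
    · simpa [F'] using Ideal.mem_map_of_mem (cst k n) (hH i j)
    · simpa [g'] using Ideal.mem_map_of_mem (cst k n) (hη i)
  obtain ⟨h', hh', hmul⟩ := exists_sub_one_mem_mul_mem (c := C (eval x h)⁻¹) heN h01
    (by simp [𝔪, RingHom.mem_ker, inv_mul_cancel₀ hx]) hh
  have hJ : Ideal.span {cst k n h'} * (𝔪.map (cst k n)) ^ N ≤
      sysIdeal F' g' ⊔ Ideal.span {param k n} := by
    rw [Ideal.span_singleton_mul_le_iff, ← Ideal.map_pow]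
    have hle : (𝔪 ^ N).map (cst k n) ≤ Submodule.comap
        (LinearMap.mulLeft (MvPolynomial (Fin n) (Polynomial k)) (cst k n h'))
        (sysIdeal F' g' ⊔ Ideal.span {param k n}) := by
      rw [Ideal.map_le_iff_le_comap]
      intro f hf
      have h1 := hmul f hf
      rw [← hmap, Ideal.mem_map_iff_of_surjective _ (spec_surjective (0 : k))] at h1
      obtain ⟨y, hy, hyf⟩ := h1
      have h2 := sub_cst_spec_mem (0 : k) y
      rw [Polynomial.C_0, C_0, sub_zero, hyf] at h2
      have h3 := sub_mem (Ideal.mem_sup_left (T := Ideal.span {param k n}) hy)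
        (Ideal.mem_sup_right h2)
      rw [sub_sub_cancel, map_mul] at h3
      exact h3
    exact fun z hz => hle hz
  have hJ' := (Ideal.pow_right_mono hJ (1 + (a + 1))).trans Ideal.sup_pow_add_le_pow_sup_pow
  rw [pow_one, mul_pow, Ideal.span_singleton_pow, Ideal.span_singleton_pow, ← pow_mul] at hJ'
  set M := 1 + (a + 1) with hM
  have h1 : cst k n h' ^ M * (param k n ^ a * f) ∈
      sysIdeal F' g' ⊔ Ideal.span {param k n ^ (a + 1)} := by
    obtain ⟨y, hy, w, hw, hyw⟩ := Submodule.mem_sup.1 (hfam hf)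
    rw [← hyw, mul_add]
    refine add_mem (Ideal.mem_sup_left (Ideal.mul_mem_left _ _ hy))
      (hJ' (Ideal.mul_mem_mul (Ideal.mem_span_singleton_self _) ?_))
    exact Ideal.pow_le_pow_right heN' hw
  obtain ⟨y, hy, w, hw, hyw⟩ := Submodule.mem_sup.1 h1
  obtain ⟨v, rfl⟩ := Ideal.mem_span_singleton'.1 hw
  have h2 : param k n ^ a * (cst k n h' ^ M * f - param k n * v) ∈ sysIdeal F' g' := by
    convert! hy using 1
    linear_combination -hyw
  have h3 := Ideal.mem_map_of_mem (spec n 0) (htop.mem_of_param_pow_mul_mem hpq hn a h2)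
  rw [hmap, map_sub, map_mul, map_mul, map_pow, spec_cst, show spec n 0 (param k n) = 0 by
    simp [spec, param], zero_mul, sub_zero] at h3
  have h4 : h' ^ M * spec n 0 f ∈ sysIdeal F₀ g₀ ⊔ 𝔪 ^ N :=
    (sup_le_sup_left (Ideal.pow_le_pow_right (Nat.le_of_succ_le heN)) _ :
      sysIdeal F₀ g₀ ⊔ 𝔪 ^ e ≤ sysIdeal F₀ g₀ ⊔ 𝔪 ^ N) (h10 h3)
  have hcop : IsCoprime (Ideal.span {h'}) 𝔪 := by
    rw [Ideal.isCoprime_iff_exists]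
    exact ⟨h', Ideal.mem_span_singleton_self _, 1 - h', by simpa using 𝔪.neg_mem hh', by ring⟩
  obtain ⟨c, hc, c', hc', hcc⟩ := Ideal.isCoprime_iff_exists.1 (hcop.pow (m := M) (n := N))
  rw [Ideal.span_singleton_pow] at hc
  obtain ⟨b, rfl⟩ := Ideal.mem_span_singleton'.1 hc
  convert! add_mem (Ideal.mul_mem_left _ b h4)
    (Ideal.mem_sup_right (S := sysIdeal F₀ g₀) (Ideal.mul_mem_right (spec n 0 f) _ hc')) using 1
  linear_combination -(spec n 0 f) * hcc

end LocalDeformation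

section Germs

variable {k : Type*} [Field k] {p q s n : ℕ}

lemma exists_coe_sub_mem {σ : Type*} [Finite σ] (J : Ideal (MvPowerSeries σ k)) {N : ℕ}
    (hJ : ∀ i, MvPowerSeries.X i ^ N ∈ J) (f : MvPowerSeries σ k) :
    ∃ P : MvPolynomial σ k, f - (P : MvPowerSeries σ k) ∈ J := by
  classical
  cases nonempty_fintype σ
  have key : ∀ S : Finset σ, ∃ u : MvPowerSeries σ k, f - u ∈ J ∧
      ∀ m, MvPowerSeries.coeff m u ≠ 0 → ∀ i ∈ S, m i < N := by
    intro S
    induction S using Finset.induction_on with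
    | empty => exact ⟨f, by simp, by simp⟩
    | insert i S _ ih =>
      obtain ⟨u, hu, hS⟩ := ih
      let v : MvPowerSeries σ k := fun m => if m i < N then MvPowerSeries.coeff m u else 0
      have hv : ∀ m, MvPowerSeries.coeff m v = if m i < N then MvPowerSeries.coeff m u else 0 :=
        fun m => rfl
      refine ⟨v, ?_, fun m hm l hl => ?_⟩
      · have hdvd : MvPowerSeries.X i ^ N ∣ u - v :=
          MvPowerSeries.X_pow_dvd_iff.2 fun m hm => by rw [map_sub, hv, if_pos hm, sub_self]
        simpa using add_mem hu (J.mem_of_dvd hdvd (hJ i))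
      · rw [hv] at hm
        split_ifs at hm with h
        · rcases Finset.mem_insert.1 hl with rfl | hl
          · exact h
          · exact hS m hm l hl
        · exact absurd rfl hm
  obtain ⟨u, hu, hN⟩ := key univ
  refine ⟨MvPowerSeries.trunc' k (Finsupp.equivFunOnFinite.symm fun _ => N) u, ?_⟩
  convert! hu using 2
  ext m
  rw [MvPolynomial.coeff_coe, MvPowerSeries.coeff_trunc']
  split_ifs with h
  · rfl
  · by_contra hm
    exact h fun i => (hN m (Ne.symm hm) i (mem_univ i)).le

/-- The expansion of a polynomial as a formal power series at a point. -/
noncomputable def germ (x : Fin n → k) : MvPolynomial (Fin n) k →ₐ[k] MvPowerSeries (Fin n) k :=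
  (coeToMvPowerSeries.algHom k).comp (aeval fun v => X v + C (x v))

lemma germ_apply (x : Fin n → k) (f : MvPolynomial (Fin n) k) :
    germ x f = ((aeval (fun v => X v + C (x v)) f : MvPolynomial (Fin n) k) :
      MvPowerSeries (Fin n) k) := by
  simp [germ]

lemma multAt_eq_finrank_germ (I : Ideal (MvPolynomial (Fin n) k)) (x : Fin n → k) :
    multAt I x = Module.finrank k (MvPowerSeries (Fin n) k ⧸ I.map (germ x)) := by
  have h : I.map ((coeToMvPowerSeries.ringHom).comp
      (aeval (fun v => X v + C (x v)) : MvPolynomial (Fin n) k →ₐ[k] _).toRingHom) =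
      I.map (germ x) := by
    refine congrArg Ideal.span (Set.image_congr fun f _ => ?_)
    simp [germ_apply]
  rw [multAt, h]

lemma exists_germ_eq_coe (x : Fin n → k) (P : MvPolynomial (Fin n) k) :
    ∃ f, germ x f = (P : MvPowerSeries (Fin n) k) := by
  refine ⟨aeval (fun v => X v - C (x v)) P, ?_⟩
  rw [germ_apply]
  congr 1
  have h : (aeval fun v => X v + C (x v) : MvPolynomial (Fin n) k →ₐ[k] _).comp
      (aeval fun v => X v - C (x v)) = AlgHom.id k (MvPolynomial (Fin n) k) := by
    ext v : 1
    simp [algHom_C]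
  exact DFunLike.congr_fun h P

lemma constantCoeff_germ (x : Fin n → k) (f : MvPolynomial (Fin n) k) :
    MvPowerSeries.constantCoeff (germ x f) = eval x f := by
  have h : (MvPowerSeries.constantCoeff (R := k)).comp (germ x).toRingHom = eval x := by
    ext v
    · simp [MvPowerSeries.algebraMap_apply]
    · simp [germ_apply]
  exact DFunLike.congr_fun h f

/-- `x` is an isolated zero of `I`, cut out scheme-theoretically by a power of its ideal off the
zero set of some polynomial. -/
def IsThickPoint (I : Ideal (MvPolynomial (Fin n) k)) (x : Fin n → k) (N : ℕ) : Prop :=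
  ∃ h : MvPolynomial (Fin n) k, eval x h ≠ 0 ∧ ∀ f ∈ ptIdeal x ^ N, h * f ∈ I

lemma IsThickPoint.germ_mem {I : Ideal (MvPolynomial (Fin n) k)} {x : Fin n → k} {N : ℕ}
    (hx : IsThickPoint I x N) {f : MvPolynomial (Fin n) k} (hf : f ∈ I ⊔ ptIdeal x ^ N) :
    germ x f ∈ I.map (germ x) := by
  obtain ⟨h, hh, hI⟩ := hx
  have hu : IsUnit (germ x h) := by
    rw [MvPowerSeries.isUnit_iff_constantCoeff, constantCoeff_germ]
    exact hh.isUnit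
  have hle : I ⊔ ptIdeal x ^ N ≤ (I.map (germ x)).comap (germ x) := by
    refine sup_le Ideal.le_comap_map fun f hf => ?_
    have := Ideal.mem_map_of_mem (germ x) (hI f hf)
    rw [map_mul] at this
    exact ((I.map (germ x)).unit_mul_mem_iff_mem hu).1 this
  exact hle hf

lemma IsThickPoint.exists_sub_germ_mem {I : Ideal (MvPolynomial (Fin n) k)} {x : Fin n → k}
    {N : ℕ} (hx : IsThickPoint I x N) (f : MvPowerSeries (Fin n) k) :
    ∃ P, f - germ x P ∈ I.map (germ x) := by
  have hX : ∀ i, (MvPowerSeries.X i : MvPowerSeries (Fin n) k) ^ N ∈ I.map (germ x) := fun i => by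
    have h1 : X i - C (x i) ∈ ptIdeal x := by simp [RingHom.mem_ker]
    have h2 := hx.germ_mem (Ideal.mem_sup_right (Ideal.pow_mem_pow h1 N))
    simpa [germ_apply, algHom_C] using h2
  obtain ⟨P, hP⟩ := exists_coe_sub_mem _ hX f
  obtain ⟨Q, hQ⟩ := exists_germ_eq_coe x P
  exact ⟨Q, by rwa [hQ]⟩

lemma isCoprime_ptIdeal_pow {x y : Fin n → k} (hxy : x ≠ y) (M N : ℕ) :
    IsCoprime (ptIdeal x ^ M) (ptIdeal y ^ N) := by
  obtain ⟨i, hi⟩ := Function.ne_iff.1 hxy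
  refine IsCoprime.pow (Ideal.isCoprime_iff_exists.2
    ⟨C (y i - x i)⁻¹ * (X i - C (x i)), ?_, C (y i - x i)⁻¹ * (C (y i) - X i), ?_, ?_⟩)
  · simp [RingHom.mem_ker]
  · simp [RingHom.mem_ker]
  · have : (C (y i - x i)⁻¹ * (X i - C (x i)) + C (y i - x i)⁻¹ * (C (y i) - X i) :
        MvPolynomial (Fin n) k) = C ((y i - x i)⁻¹ * (y i - x i)) := by
      simp only [C_mul, C_sub]
      ring
    rw [this, inv_mul_cancel₀ (sub_ne_zero.2 (Ne.symm hi)), C_1]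

/-- Simultaneous expansion at the points of a finite set. -/
noncomputable def jointGerm (I : Ideal (MvPolynomial (Fin n) k)) (pts : Finset (Fin n → k)) :
    MvPolynomial (Fin n) k →ₗ[k]
      ∀ x : pts, MvPowerSeries (Fin n) k ⧸ I.map (germ (x : Fin n → k)) :=
  LinearMap.pi fun x =>
    ((Ideal.Quotient.mkₐ k (I.map (germ (x : Fin n → k)))).comp (germ (x : Fin n → k))).toLinearMap

lemma jointGerm_apply (I : Ideal (MvPolynomial (Fin n) k)) (pts : Finset (Fin n → k)) (f)
    (x : pts) : jointGerm I pts f x = Ideal.Quotient.mk _ (germ (x : Fin n → k) f) := rfl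

variable {I : Ideal (MvPolynomial (Fin n) k)} {pts : Finset (Fin n → k)} {N : pts → ℕ}

lemma jointGerm_surjective (h : ∀ x : pts, IsThickPoint I x (N x)) :
    Function.Surjective (jointGerm I pts) := by
  intro u
  choose v hv using fun x => Ideal.Quotient.mk_surjective (u x)
  choose P hP using fun x => (h x).exists_sub_germ_mem (v x)
  obtain ⟨r, hr⟩ := Ideal.exists_forall_sub_mem_ideal
    (I := fun x : pts => ptIdeal (x : Fin n → k) ^ N x)
    (fun x y hxy => isCoprime_ptIdeal_pow (Subtype.coe_injective.ne hxy) _ _) P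
  refine ⟨r, funext fun x => ?_⟩
  rw [jointGerm_apply, ← hv, eq_comm, Ideal.Quotient.eq]
  have := (h x).germ_mem (Ideal.mem_sup_right (hr x))
  rw [map_sub] at this
  simpa using sub_mem (hP x) this

lemma jointGerm_eq_zero (h : ∀ x : pts, IsThickPoint I x (N x)) {f : MvPolynomial (Fin n) k}
    (hf : ∀ x : pts, f ∈ I ⊔ ptIdeal (x : Fin n → k) ^ N x) : jointGerm I pts f = 0 := by
  funext x
  rw [jointGerm_apply, Pi.zero_apply, Ideal.Quotient.eq_zero_iff_mem]
  exact (h x).germ_mem (hf x)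

end Germs

section Bound

variable {k : Type*} [Field k] {p q s n : ℕ}

lemma joinPoly_mem_degLT {e : ℕ} {f h : MvPolynomial (Fin n) k}
    (hf : f ∈ degLT (Fin n) k e) (hh : h ∈ degLT (Fin n) k e) :
    joinPoly f h ∈ degLT (Fin n) (Polynomial k) e := by
  rw [joinPoly, ← smul_eq_C_mul]
  exact add_mem (map_mem_degLT _ hf) (Submodule.smul_mem _ _ (map_mem_degLT _ (sub_mem hh hf)))

theorem sum_finrank_germ_le [CharZero k] (hpq : p + 1 ≤ q) (hn : n + (p + 1) = q + s + 1)
    {d : Fin q ⊕ Fin s → ℕ} {F : Matrix (Fin (p + 1)) (Fin q) (MvPolynomial (Fin n) k)}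
    {g : Fin s → MvPolynomial (Fin n) k}
    (hF : ∀ i j, F i j ∈ degLT (Fin n) k (d (Sum.inl j) + 1))
    (hg : ∀ i, g i ∈ degLT (Fin n) k (d (Sum.inr i) + 1)) (pts : Finset (Fin n → k))
    (hpts : ∀ x ∈ pts, ∃ N, IsThickPoint (sysIdeal F g) x N) :
    ∑ x ∈ pts, Module.finrank k (MvPowerSeries (Fin n) k ⧸ (sysIdeal F g).map (germ x)) ≤
      detBound (p + 1) d := by
  choose N hN using fun x : pts => hpts x x.2
  have hrank : Module.rank k (∀ x : pts, MvPowerSeries (Fin n) k ⧸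
      (sysIdeal F g).map (germ (x : Fin n → k))) ≤ detBound (p + 1) d := by
    refine rank_le fun S hS => ?_
    by_contra! hlt
    choose f hf using fun u : S => jointGerm_surjective hN (u : ∀ x : pts, _)
    obtain ⟨a, r, ⟨i, hi⟩, hr⟩ := exists_relation hpq hn
      (F := Matrix.of fun i j => joinPoly (F i j) (starMat (p + 1) n d 0 i j))
      (g := fun i => joinPoly (g i) (starEqs n d 0 i))
      (fun i j => joinPoly_mem_degLT (hF i j) (starMat_isTop d 0 i j).mem_degLT)
      (fun i => joinPoly_mem_degLT (hg i) (starProd_isTop d 0 (Sum.inr i)).mem_degLT)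
      (fun i j => spec_one_joinPoly _ _) (fun i => spec_one_joinPoly _ _)
      (by simpa using hlt) f
    refine hi (Fintype.linearIndependent_iff.1 hS (fun u => (r u).eval 0) ?_ i)
    have hzero := jointGerm_eq_zero hN fun x => by
      obtain ⟨h, hx, hh⟩ := hN x
      exact spec_mem_of_param_pow_mul_mem hpq hn (fun i j => spec_zero_joinPoly _ _)
        (fun i => spec_zero_joinPoly _ _) hx hh hr
    rw [spec_sum, map_sum] at hzero
    rw [← hzero]
    refine Finset.sum_congr rfl fun u _ => ?_
    rw [← smul_eq_C_mul, map_smul, hf]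
  have hfin : Module.Finite k (∀ x : pts, MvPowerSeries (Fin n) k ⧸
      (sysIdeal F g).map (germ (x : Fin n → k))) :=
    Module.rank_lt_aleph0_iff.1 (hrank.trans_lt Cardinal.natCast_lt_aleph0)
  have hfin' : ∀ x : pts, Module.Finite k (MvPowerSeries (Fin n) k ⧸
      (sysIdeal F g).map (germ (x : Fin n → k))) := fun x =>
    Module.Finite.of_surjective (LinearMap.proj (R := k) (φ := fun x : pts =>
      MvPowerSeries (Fin n) k ⧸ (sysIdeal F g).map (germ (x : Fin n → k))) x)
      (LinearMap.proj_surjective x)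
  have := Module.finrank_le_of_rank_le hrank
  rw [Module.finrank_pi_fintype] at this
  rwa [← Finset.sum_coe_sort]

end Bound

section Isolated

variable {k : Type*} [Field k] {n : ℕ}

lemma exists_isThickPoint [IsAlgClosed k] {I : Ideal (MvPolynomial (Fin n) k)} {x : Fin n → k}
    (hx : IsIsolatedZero I x) : ∃ N, IsThickPoint I x N := by
  obtain ⟨-, h, hh, hiso⟩ := hx
  have hle : Ideal.span {h} * ptIdeal x ≤ I.radical := by
    rw [← vanishingIdeal_zeroLocus_eq_radical (K := k), Ideal.span_singleton_mul_le_iff]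
    intro f hf y hy
    change eval y (h * f) = 0
    rw [map_mul]
    by_cases hyh : eval y h = 0
    · rw [hyh, zero_mul]
    · rw [hiso y (fun f hf => hy f hf) hyh,
        RingHom.mem_ker.1 hf, mul_zero]
  obtain ⟨N, hN⟩ := Ideal.exists_pow_le_of_le_radical_of_fg hle (IsNoetherian.noetherian _)
  rw [mul_pow, Ideal.span_singleton_pow, Ideal.span_singleton_mul_le_iff] at hN
  exact ⟨N, h ^ N, by simpa using pow_ne_zero N hh, hN⟩

end Isolated

section Statement

variable {K : Type*} [Field K] {p q s n : ℕ}

lemma detIdeal_eq_sysIdeal (F : Matrix (Fin p) (Fin q) (MvPolynomial (Fin n) K))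
    (g : Fin s → MvPolynomial (Fin n) K) :
    detIdeal F g = sysIdeal (F.map (MvPolynomial.map (algebraMap K (AlgebraicClosure K))))
      fun i => MvPolynomial.map (algebraMap K (AlgebraicClosure K)) (g i) := by
  rw [detIdeal, sysIdeal, ← Ideal.span_union]
  congr 1
  ext f
  simp [sysGen, eq_comm]

lemma not_isIsolatedZero_of_no_rows (F : Matrix (Fin 0) (Fin q) (MvPolynomial (Fin n) K))
    (g : Fin s → MvPolynomial (Fin n) K) (x : Fin n → AlgebraicClosure K) :
    ¬ IsIsolatedZero (detIdeal F g) x := fun h => by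
  have h1 : (1 : MvPolynomial (Fin n) (AlgebraicClosure K)) ∈ detIdeal F g :=
    Ideal.mem_sup_left (Ideal.subset_span ⟨⟨Fin.elim0, fun i => i.elim0⟩, by simp⟩)
  simpa using h.1 1 h1

end Statement

end DetBound

/-- Column-degree bound: for `F ∈ K[X₁,…,Xₙ]^{p×q}` (`p ≤ q`), `G = (g₁,…,g_s)`,
and `n = q - p + s + 1`, the sum of the multiplicities of the isolated points of
`V(I_p(F) + ⟨g₁,…,g_s⟩)` (over the algebraic closure) is at most
`deg g₁ ⋯ deg g_s · E_{n-s}(cdeg(F,1),…,cdeg(F,q))`, where `cdeg(F,j)` is the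
maximum degree in column `j` and `E_k` is the elementary symmetric polynomial. -/
theorem stmt14 (K : Type*) [Field K] [CharZero K]
    (p q s n : ℕ) (hpq : p ≤ q) (hn : n = q - p + s + 1)
    (F : Matrix (Fin p) (Fin q) (MvPolynomial (Fin n) K))
    (g : Fin s → MvPolynomial (Fin n) K) :
    ∀ pts : Finset (Fin n → AlgebraicClosure K),
      (∀ x ∈ pts, IsIsolatedZero (detIdeal F g) x) →
      ∑ x ∈ pts, multAt (detIdeal F g) x ≤
        (∏ i, (g i).totalDegree) *
          ∑ t ∈ (Finset.univ : Finset (Fin q)).powerset.filter (fun t => t.card = n - s),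
            ∏ j ∈ t, (Finset.univ.sup fun i : Fin p => (F i j).totalDegree) := by
  intro pts hpts
  rcases p with _ | p
  · rw [Finset.eq_empty_of_forall_notMem fun x hx =>
      DetBound.not_isIsolatedZero_of_no_rows F g x (hpts x hx)]
    simp
  let d : Fin q ⊕ Fin s → ℕ :=
    Sum.elim (fun j => univ.sup fun i => (F i j).totalDegree) fun i => (g i).totalDegree
  have hF : ∀ i j, (F.map (map (algebraMap K (AlgebraicClosure K)))) i j ∈
      DetBound.degLT (Fin n) (AlgebraicClosure K) (d (Sum.inl j) + 1) := fun i j =>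
    DetBound.map_mem_degLT _ (DetBound.mem_degLT_of_totalDegree_le
      (Finset.le_sup (f := fun i => (F i j).totalDegree) (mem_univ i)))
  have hg : ∀ i, map (algebraMap K (AlgebraicClosure K)) (g i) ∈
      DetBound.degLT (Fin n) (AlgebraicClosure K) (d (Sum.inr i) + 1) := fun i =>
    DetBound.map_mem_degLT _ (DetBound.exists_mem_degLT _)
  have hbound := DetBound.sum_finrank_germ_le hpq (by omega) hF hg pts fun x hx =>
    DetBound.exists_isThickPoint (DetBound.detIdeal_eq_sysIdeal F g ▸ hpts x hx)
  rw [← Finset.powersetCard_eq_filter, show n - s = q + 1 - (p + 1) by omega]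
  calc ∑ x ∈ pts, multAt (detIdeal F g) x = _ := Finset.sum_congr rfl fun x _ => by
        rw [DetBound.multAt_eq_finrank_germ, DetBound.detIdeal_eq_sysIdeal]
    _ ≤ _ := hbound
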